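/- arXiv:1912.03900 — 4 statements merged into one kernel-verified Lean document; each statement's English description precedes it below -/
import Mathlib

section
/- For every integer d ≥ 4, if P is a 2-neighborly d-polytope with at least d+4 vertices such that every facet of P has at most d+1 vertices, then P has at least 2d+3 facets. -/
open Set

/-- A polytope is the convex hull of a finite set of points. -/
def IsPolytope {N : ℕ} (P : Set (Fin N → ℝ)) : Prop :=
  ∃ S : Finset (Fin N → ℝ), P = convexHull ℝ (S : Set (Fin N → ℝ))

/-- The dimension of a set: the dimension of its affine span. -/
noncomputable def pdim {N : ℕ} (P : Set (Fin N → ℝ)) : ℕ :=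
  Module.finrank ℝ (affineSpan ℝ P).direction

/-- A vertex is a 0-dimensional (exposed) face, i.e. an exposed singleton. -/
def IsVertex {N : ℕ} (P : Set (Fin N → ℝ)) (v : Fin N → ℝ) : Prop :=
  IsExposed ℝ P {v}

/-- The set of vertices of `P`. -/
def vertexSet {N : ℕ} (P : Set (Fin N → ℝ)) : Set (Fin N → ℝ) :=
  {v | IsVertex P v}

/-- A facet is a nonempty exposed face of dimension one less than the polytope. -/
def IsFacetOf {N : ℕ} (P F : Set (Fin N → ℝ)) : Prop :=
  IsExposed ℝ P F ∧ F.Nonempty ∧ pdim F + 1 = pdim P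

/-- The set of facets of `P`. -/
def facetSet {N : ℕ} (P : Set (Fin N → ℝ)) : Set (Set (Fin N → ℝ)) :=
  {F | IsFacetOf P F}

/-- A polytope is 2-neighborly if every pair of distinct vertices is the vertex set of
an edge (1-dimensional face), i.e. the segment between them is an exposed face. -/
def TwoNeighborly {N : ℕ} (P : Set (Fin N → ℝ)) : Prop :=
  ∀ u v : Fin N → ℝ, IsVertex P u → IsVertex P v → u ≠ v →
    IsExposed ℝ P (convexHull ℝ {u, v}) ∧ pdim (convexHull ℝ ({u, v} : Set (Fin N → ℝ))) = 1

/-- A polytope is 2-simplicial if every 2-dimensional face has exactly 3 vertices. -/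
def TwoSimplicial {N : ℕ} (P : Set (Fin N → ℝ)) : Prop :=
  ∀ F : Set (Fin N → ℝ), IsExposed ℝ P F → F.Nonempty → pdim F = 2 →
    (vertexSet F).ncard = 3

/-- A polytope is a pyramid if some vertex (the apex) is not in the affine span
of the remaining vertices. -/
def IsPyramid {N : ℕ} (P : Set (Fin N → ℝ)) : Prop :=
  ∃ v : Fin N → ℝ, IsVertex P v ∧ v ∉ affineSpan ℝ (vertexSet P \ {v})

/-- `P` is a pyramid over `Q`: `Q` is a facet of `P` and `P` is the convex hull of `Q`
together with one additional point (the apex) not in the affine span of `Q`. -/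
def IsPyramidOver {N : ℕ} (P Q : Set (Fin N → ℝ)) : Prop :=
  IsFacetOf P Q ∧ ∃ a : Fin N → ℝ, a ∉ affineSpan ℝ Q ∧ P = convexHull ℝ (Q ∪ {a})

/-- `P` is a `k`-fold pyramid over `Q`. -/
def IsKFoldPyramidOver {N : ℕ} : ℕ → Set (Fin N → ℝ) → Set (Fin N → ℝ) → Prop
  | 0, P, Q => P = Q
  | k + 1, P, Q => ∃ R : Set (Fin N → ℝ), IsKFoldPyramidOver k R Q ∧ IsPyramidOver P R

/-- `F` is the zero set of a nonnegative function spanning an extreme ray of the cone of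
nonnegative functions in `U`. -/
def IsExtremeZeroSet {V : Type*} (U : Submodule ℝ (V → ℝ)) (F : Finset V) : Prop :=
  ∃ y ∈ U, (∀ v, 0 ≤ y v) ∧ y ≠ 0 ∧ (∀ v, v ∈ F ↔ y v = 0) ∧
    ∀ g ∈ U, (∀ v ∈ F, g v = 0) → ∃ c : ℝ, g = c • y

/-- The functions in `U` vanishing on `S`. -/
def vanishingOn {V : Type*} (U : Submodule ℝ (V → ℝ)) (S : Finset V) : Submodule ℝ (V → ℝ) where
  carrier := {g | g ∈ U ∧ ∀ v ∈ S, g v = 0}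
  add_mem' := fun ha hb => ⟨U.add_mem ha.1 hb.1, fun v hv => by simp [ha.2 v hv, hb.2 v hv]⟩
  zero_mem' := ⟨U.zero_mem, fun _ _ => rfl⟩
  smul_mem' := fun c x hx => ⟨U.smul_mem c hx.1, fun v hv => by simp [hx.2 v hv]⟩

lemma exists_sub_mul_nonneg {V : Type*} (T : Finset V) (e g : V → ℝ)
    (he : ∀ v ∈ T, 0 ≤ e v) (hg : ∃ v ∈ T, 0 < g v) :
    ∃ t : ℝ, 0 ≤ t ∧ (∀ v ∈ T, 0 ≤ e v - t * g v) ∧ ∃ v ∈ T, 0 < g v ∧ e v - t * g v = 0 := by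
  classical
  obtain ⟨v₀, hv₀, hgv₀⟩ := hg
  obtain ⟨v, hv, hmin⟩ := (T.filter (fun v => 0 < g v)).exists_min_image (fun v => e v / g v)
    ⟨v₀, by simp [hv₀, hgv₀]⟩
  rw [Finset.mem_filter] at hv
  have ht : 0 ≤ e v / g v := div_nonneg (he v hv.1) hv.2.le
  refine ⟨e v / g v, ht, fun w hw => ?_, v, hv.1, hv.2, ?_⟩
  · rcases lt_or_ge 0 (g w) with h | h
    · have := hmin w (by simp [hw, h])
      rw [le_div_iff₀ h] at this
      linarith
    · nlinarith [he w hw]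
  · rw [div_mul_cancel₀ _ hv.2.ne']
    ring

lemma exists_add_mul_nonneg {V : Type*} (T : Finset V) (hT : T.Nonempty) (g y : V → ℝ)
    (hy : ∀ v ∈ T, 0 < y v) :
    ∃ t : ℝ, (∀ v ∈ T, 0 ≤ g v + t * y v) ∧ ∃ v ∈ T, g v + t * y v = 0 := by
  obtain ⟨v, hv, hmin⟩ := T.exists_min_image (fun v => g v / y v) hT
  refine ⟨-(g v / y v), fun w hw => ?_, v, hv, ?_⟩
  · have := hmin w hw
    rw [le_div_iff₀ (hy w hw)] at this
    linarith
  · rw [neg_mul, div_mul_cancel₀ _ (hy v hv).ne']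
    ring

lemma exists_add_mul_pos {V : Type*} (T : Finset V) (g y : V → ℝ) (hy : ∀ v ∈ T, 0 < y v) :
    ∃ t : ℝ, ∀ v ∈ T, 0 < g v + t * y v := by
  rcases T.eq_empty_or_nonempty with rfl | hT
  · exact ⟨0, by simp⟩
  obtain ⟨t, ht, -⟩ := exists_add_mul_nonneg T hT g y hy
  exact ⟨t + 1, fun v hv => by linarith [ht v hv, hy v hv]⟩

/-- Restriction of the functions in `U` to `S`. -/
def restrictTo {V : Type*} (U : Submodule ℝ (V → ℝ)) (S : Finset V) : U →ₗ[ℝ] (S → ℝ) :=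
  (LinearMap.funLeft ℝ ℝ (Subtype.val : S → V)).comp U.subtype

lemma finrank_range_restrictTo_add {V : Type*} [Finite V] (U : Submodule ℝ (V → ℝ))
    (S : Finset V) :
    Module.finrank ℝ (LinearMap.range (restrictTo U S)) + Module.finrank ℝ (vanishingOn U S) =
      Module.finrank ℝ U := by
  have h3 : (LinearMap.ker (restrictTo U S)).map U.subtype = vanishingOn U S := by
    ext g
    simp only [Submodule.mem_map, LinearMap.mem_ker]
    constructor
    · rintro ⟨x, hx, rfl⟩
      exact ⟨x.2, fun v hv => congrFun hx ⟨v, hv⟩⟩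
    · rintro ⟨hg, hv⟩
      exact ⟨⟨g, hg⟩, by ext ⟨v, hvS⟩; exact hv v hvS, rfl⟩
  rw [← (restrictTo U S).finrank_range_add_finrank_ker, ← h3]
  congr 1
  exact (LinearEquiv.finrank_eq (Submodule.equivMapOfInjective U.subtype U.injective_subtype
    (LinearMap.ker (restrictTo U S)))).symm

lemma finrank_le_finrank_vanishingOn_add_card {V : Type*} [Finite V] (U : Submodule ℝ (V → ℝ))
    (S : Finset V) :
    Module.finrank ℝ U ≤ Module.finrank ℝ (vanishingOn U S) + S.card := by
  have h1 := finrank_range_restrictTo_add U S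
  have h2 : Module.finrank ℝ (LinearMap.range (restrictTo U S)) ≤ S.card := by
    simpa using Submodule.finrank_le (LinearMap.range (restrictTo U S))
  omega

lemma mem_span_of_nonneg {V : Type*} [Fintype V] (U : Submodule ℝ (V → ℝ))
    (φ : Finset V → V → ℝ)
    (hφ : ∀ F, IsExtremeZeroSet U F → φ F ∈ U ∧ φ F ≠ 0 ∧ ∀ v ∈ F, φ F v = 0)
    (n : ℕ) (y : V → ℝ) (hyU : y ∈ U) (hy : ∀ v, 0 ≤ y v)
    (hn : (Finset.univ.filter (fun v => y v ≠ 0)).card ≤ n) :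
    y ∈ Submodule.span ℝ
      (φ '' {F | IsExtremeZeroSet U F ∧ ∀ v, y v = 0 → v ∈ F}) := by
  classical
  induction n generalizing y with
  | zero =>
    have : y = 0 := by
      ext v
      by_contra h
      have : v ∈ Finset.univ.filter (fun v => y v ≠ 0) := by simpa using h
      rw [Finset.card_eq_zero.mp (Nat.le_zero.mp hn)] at this
      simp at this
    rw [this]
    exact Submodule.zero_mem _
  | succ n ih =>
    by_cases h0 : y = 0
    · rw [h0]
      exact Submodule.zero_mem _
    by_cases hext : ∀ g ∈ U, (∀ v, y v = 0 → g v = 0) → ∃ c : ℝ, g = c • y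
    · set F := Finset.univ.filter (fun v => y v = 0) with hF
      have hFe : IsExtremeZeroSet U F :=
        ⟨y, hyU, hy, h0, by simp [hF], fun g hg hgF => hext g hg (by simpa [hF] using hgF)⟩
      obtain ⟨h1, h2, h3⟩ := hφ F hFe
      obtain ⟨c, hc⟩ := hext (φ F) h1 (by simpa [hF] using h3)
      have hc0 : c ≠ 0 := by
        rintro rfl
        exact h2 (by simp [hc])
      have : y = c⁻¹ • φ F := by rw [hc, smul_smul, inv_mul_cancel₀ hc0, one_smul]
      rw [this]
      refine Submodule.smul_mem _ _ (Submodule.subset_span ⟨F, ⟨hFe, fun v hv => ?_⟩, rfl⟩)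
      rw [← this] at hv
      simpa [hF] using hv
    · push Not at hext
      obtain ⟨g, hgU, hgZ, hgc⟩ := hext
      have hstep : ∀ a ∈ U, (∀ v, 0 ≤ a v) → (∀ v, y v = 0 → a v = 0) →
          (∃ v, y v ≠ 0 ∧ a v = 0) → a ∈ Submodule.span ℝ
            (φ '' {F | IsExtremeZeroSet U F ∧ ∀ v, y v = 0 → v ∈ F}) := by
        rintro a haU ha haZ ⟨v, hv1, hv2⟩
        refine Submodule.span_mono (Set.image_mono ?_) (ih a haU ha ?_)
        · exact fun F hF => ⟨hF.1, fun v hv => hF.2 v (haZ v hv)⟩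
        · have : (Finset.univ.filter (fun v => a v ≠ 0)).card <
              (Finset.univ.filter (fun v => y v ≠ 0)).card := by
            refine Finset.card_lt_card ⟨fun w hw => ?_, fun h => ?_⟩
            · simp only [Finset.mem_filter, Finset.mem_univ, true_and] at hw ⊢
              exact fun h => hw (haZ w h)
            · have := h (by simpa using hv1 : v ∈ Finset.univ.filter (fun v => y v ≠ 0))
              simp [hv2] at this
          omega
      obtain ⟨w, hw⟩ : ∃ w, y w ≠ 0 := by
        by_contra! h
        exact h0 (funext h)
      obtain ⟨t, ht, v, hv, hvt⟩ := exists_add_mul_nonneg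
        (Finset.univ.filter (fun v => y v ≠ 0)) ⟨w, by simpa using hw⟩ g y
        (fun v hv => lt_of_le_of_ne (hy v) (Ne.symm (by simpa using hv)))
      have haU : g + t • y ∈ U := U.add_mem hgU (U.smul_mem t hyU)
      have haZ : ∀ v, y v = 0 → (g + t • y) v = 0 := fun v hv => by simp [hv, hgZ v hv]
      have ha : ∀ v, 0 ≤ (g + t • y) v := fun v => by
        by_cases h : y v = 0
        · rw [haZ v h]
        · simpa using ht v (by simpa using h)
      have hane : ∃ v ∈ (Finset.univ : Finset V), 0 < (g + t • y) v := by
        by_contra! h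
        refine hgc (-t) (funext fun v => ?_)
        have := le_antisymm (h v (Finset.mem_univ v)) (ha v)
        simp only [Pi.add_apply, Pi.smul_apply, smul_eq_mul] at this ⊢
        linarith
      have h1 := hstep _ haU ha haZ ⟨v, by simpa using hv, by simpa using hvt⟩
      obtain ⟨s, -, hs, x, -, hx1, hx2⟩ :=
        exists_sub_mul_nonneg Finset.univ y (g + t • y) (fun v _ => hy v) hane
      have h2 := hstep (y - s • (g + t • y)) (U.sub_mem hyU (U.smul_mem s haU))
        (fun v => hs v (Finset.mem_univ v))
        (fun v hv => by simp only [Pi.sub_apply, Pi.smul_apply, haZ v hv, hv]; simp)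
        ⟨x, fun h => hx1.ne' (haZ x h), hx2⟩
      have h3 := Submodule.add_mem _ h2 (Submodule.smul_mem _ s h1)
      rwa [sub_add_cancel] at h3

open Classical in
/-- The finite family of extreme zero sets. -/
noncomputable def extremeZeroSets {V : Type*} [Fintype V] (U : Submodule ℝ (V → ℝ)) :
    Finset (Finset V) :=
  Finset.univ.filter (IsExtremeZeroSet U)

lemma mem_extremeZeroSets {V : Type*} [Fintype V] {U : Submodule ℝ (V → ℝ)} {F : Finset V} :
    F ∈ extremeZeroSets U ↔ IsExtremeZeroSet U F := by
  simp [extremeZeroSets]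

open Classical in
lemma finrank_vanishingOn_le_card {V : Type*} [Fintype V] (U : Submodule ℝ (V → ℝ))
    (Z : Finset V) (y : V → ℝ) (hyU : y ∈ U) (hy : ∀ v, 0 ≤ y v) (hZ : ∀ v, v ∈ Z ↔ y v = 0) :
    Module.finrank ℝ (vanishingOn U Z) ≤ ((extremeZeroSets U).filter (Z ⊆ ·)).card := by
  choose! φ hφU hφ0 hφne hφZ _ using
    fun (F : Finset V) (hF : IsExtremeZeroSet U F) => hF
  set A := ((extremeZeroSets U).filter (Z ⊆ ·)).image φ
  have hsub : ∀ y' ∈ U, (∀ v, 0 ≤ y' v) → (∀ v ∈ Z, y' v = 0) →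
      y' ∈ Submodule.span ℝ (A : Set (V → ℝ)) := by
    intro y' h1 h2 h3
    refine Submodule.span_mono ?_ (mem_span_of_nonneg U φ
      (fun F hF => ⟨hφU F hF, hφne F hF, fun v hv => (hφZ F hF v).mp hv⟩) _ y' h1 h2 le_rfl)
    rintro _ ⟨F, hF, rfl⟩
    simp only [A, Finset.coe_image]
    exact ⟨F, by simpa [mem_extremeZeroSets] using
      ⟨hF.1, fun v hv => hF.2 v (h3 v hv)⟩, rfl⟩
  have hle : vanishingOn U Z ≤ Submodule.span ℝ (A : Set (V → ℝ)) := by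
    rintro g ⟨hgU, hgZ⟩
    obtain ⟨t, ht⟩ := exists_add_mul_pos (Finset.univ.filter (fun v => y v ≠ 0)) g y
      (fun v hv => lt_of_le_of_ne (hy v) (Ne.symm (by simpa using hv)))
    have h1 := hsub (g + t • y) (U.add_mem hgU (U.smul_mem t hyU)) (fun v => by
      by_cases h : y v = 0
      · simp [h, hgZ v ((hZ v).mpr h)]
      · simpa using (ht v (by simpa using h)).le)
      (fun v hv => by simp [hgZ v hv, (hZ v).mp hv])
    have h2 := hsub y hyU hy (fun v hv => (hZ v).mp hv)
    have : g = (g + t • y) - t • y := by abel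
    rw [this]
    exact Submodule.sub_mem _ h1 (Submodule.smul_mem _ _ h2)
  calc _ ≤ _ := Submodule.finrank_mono hle
    _ ≤ A.card := finrank_span_finset_le_card A
    _ ≤ _ := Finset.card_image_le

open Classical in
lemma exists_adjacent {V : Type*} [Fintype V] (U : Submodule ℝ (V → ℝ)) (F : Finset V)
    (hF : IsExtremeZeroSet U F) (e : V → ℝ) (heU : e ∈ U) (he : ∀ v ∈ F, 0 ≤ e v)
    (i : V) (hiF : i ∈ F) (hi : 0 < e i) :
    ∃ G, IsExtremeZeroSet U G ∧ (∀ v ∈ F, e v = 0 → v ∈ G) ∧ i ∉ G ∧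
      Module.finrank ℝ U ≤ (F ∩ G).card + 2 := by
  obtain ⟨l, hlU, hl, hl0, hlF, hlext⟩ := hF
  obtain ⟨Z, hZ, hmax⟩ := (F.powerset.filter (fun Z => ∃ e' ∈ U, (∀ v ∈ F, 0 ≤ e' v) ∧ 0 < e' i ∧
      (∀ v ∈ F, e v = 0 → e' v = 0) ∧ ∀ v ∈ F, v ∈ Z ↔ e' v = 0)).exists_max_image Finset.card
    ⟨F.filter (fun v => e v = 0), by
      simp only [Finset.mem_filter, Finset.mem_powerset, Finset.filter_subset, true_and]
      exact ⟨e, heU, he, hi, fun _ _ h => h, fun v hv => by simp [hv]⟩⟩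
  obtain ⟨hZF, e', heU', he', hi', hee', hZe'⟩ := by
    simpa only [Finset.mem_filter, Finset.mem_powerset] using hZ
  have hpos : ∀ k ∈ U, (∀ v ∈ Z, k v = 0) → k i = 0 → ∀ v ∈ F, k v ≤ 0 := by
    intro k hkU hkZ hki
    by_contra! hcon
    obtain ⟨t, -, ht, w, hwF, hkw, hw⟩ := exists_sub_mul_nonneg F e' k he' hcon
    have hwZ : w ∉ Z := fun h => hkw.ne' (hkZ w h)
    have hsub : Z ⊆ F.filter (fun v => e' v - t * k v = 0) := fun v hv => by
      simp [hZF hv, hkZ v hv, (hZe' v (hZF hv)).mp hv]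
    have hlt : Z.card < (F.filter (fun v => e' v - t * k v = 0)).card :=
      Finset.card_lt_card ⟨hsub, fun h => hwZ (h (by simp [hwF, hw]))⟩
    refine absurd (hmax (F.filter (fun v => e' v - t * k v = 0)) ?_) hlt.not_ge
    simp only [Finset.mem_filter, Finset.mem_powerset, Finset.filter_subset, true_and]
    refine ⟨e' - t • k, U.sub_mem heU' (U.smul_mem t hkU), ht, by simpa [hki] using hi', ?_, ?_⟩
    · intro v hv h
      have h1 := hee' v hv h
      simp [h1, hkZ v ((hZe' v hv).mpr h1)]
    · intro v hv
      simp [hv]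
  have hzero : ∀ k ∈ U, (∀ v ∈ Z, k v = 0) → k i = 0 → ∃ c : ℝ, k = c • l := by
    intro k hkU hkZ hki
    refine hlext k hkU fun v hv => le_antisymm (hpos k hkU hkZ hki v hv) ?_
    have := hpos (-k) (U.neg_mem hkU) (fun v hv => by simp [hkZ v hv]) (by simp [hki]) v hv
    simpa using this
  have hrank : Module.finrank ℝ U ≤ Z.card + 2 := by
    have h1 := finrank_le_finrank_vanishingOn_add_card U (insert i Z)
    have h2 : vanishingOn U (insert i Z) ≤ Submodule.span ℝ {l} := by
      rintro k ⟨hkU, hk⟩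
      obtain ⟨c, rfl⟩ := hzero k hkU (fun v hv => hk v (by simp [hv])) (hk i (by simp))
      exact Submodule.smul_mem _ _ (Submodule.mem_span_singleton_self l)
    have h3 := (Submodule.finrank_mono h2).trans (finrank_span_singleton hl0).le
    have h4 := Finset.card_insert_le i Z
    omega
  obtain ⟨w, hw⟩ : ∃ w, l w ≠ 0 := by
    by_contra! h
    exact hl0 (funext h)
  obtain ⟨t, ht, o, ho, hot⟩ := exists_add_mul_nonneg
    (Finset.univ.filter (fun v => l v ≠ 0)) ⟨w, by simpa using hw⟩ e' l
    (fun v hv => lt_of_le_of_ne (hl v) (Ne.symm (by simpa using hv)))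
  have hlo : l o ≠ 0 := by simpa using ho
  have hyF : ∀ v ∈ F, e' v + t * l v = e' v := fun v hv => by simp [(hlF v).mp hv]
  refine ⟨Finset.univ.filter (fun v => e' v + t * l v = 0),
    ⟨e' + t • l, U.add_mem heU' (U.smul_mem t hlU), fun v => ?_, fun h => ?_, by simp, ?_⟩,
    ?_, ?_, hrank.trans ?_⟩
  · by_cases h : l v = 0
    · have hv := (hlF v).mpr h
      exact (he' v hv).trans_eq (hyF v hv).symm
    · exact ht v (by simpa using h)
  · have := congrFun h i
    exact hi'.ne' ((hyF i hiF).symm.trans this)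
  · intro k hkU hk
    have hki : (k - (k i / e' i) • (e' + t • l)) i = 0 := by
      simp [(hlF i).mp hiF, hi'.ne']
    obtain ⟨c, hc⟩ := hzero (k - (k i / e' i) • (e' + t • l))
      (U.sub_mem hkU (U.smul_mem _ (U.add_mem heU' (U.smul_mem t hlU)))) (fun v hv => by
        have h1 : e' v + t * l v = 0 := by
          rw [hyF v (hZF hv)]
          exact (hZe' v (hZF hv)).mp hv
        have h2 := hk v (by simpa using h1)
        simp only [Pi.sub_apply, Pi.smul_apply, Pi.add_apply, smul_eq_mul]
        rw [h1, h2]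
        simp) hki
    have hco := congrFun hc o
    have hko := hk o (by simpa using hot)
    simp only [Pi.sub_apply, Pi.smul_apply, Pi.add_apply, smul_eq_mul, hot, hko, mul_zero,
      sub_zero] at hco
    have hc0 : c = 0 := by
      rcases mul_eq_zero.mp hco.symm with h | h
      · exact h
      · exact absurd h hlo
    exact ⟨k i / e' i, by rw [hc0, zero_smul] at hc; exact sub_eq_zero.mp hc⟩
  · intro v hv h
    simpa using (hyF v hv).trans (hee' v hv h)
  · simp [hyF i hiF, hi'.ne']
  · gcongr
    intro v hv
    have hvF := hZF hv
    simpa [hvF] using (hyF v hvF).trans ((hZe' v hvF).mp hv)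

lemma IsExtremeZeroSet.finrank_le_card_add_one {V : Type*} [Finite V]
    {U : Submodule ℝ (V → ℝ)} {F : Finset V} (hF : IsExtremeZeroSet U F) :
    Module.finrank ℝ U ≤ F.card + 1 := by
  obtain ⟨l, hlU, hl, hl0, hlF, hlext⟩ := hF
  have h1 := finrank_le_finrank_vanishingOn_add_card U F
  have h2 : vanishingOn U F ≤ Submodule.span ℝ {l} := by
    rintro k ⟨hkU, hk⟩
    obtain ⟨c, rfl⟩ := hlext k hkU hk
    exact Submodule.smul_mem _ _ (Submodule.mem_span_singleton_self l)
  have h3 := (Submodule.finrank_mono h2).trans (finrank_span_singleton hl0).le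
  omega

lemma IsExtremeZeroSet.eq_of_subset {V : Type*} {U : Submodule ℝ (V → ℝ)} {F G : Finset V}
    (hF : IsExtremeZeroSet U F) (hG : IsExtremeZeroSet U G) (h : F ⊆ G) : F = G := by
  obtain ⟨l, hlU, hl, hl0, hlF, hlext⟩ := hF
  obtain ⟨m, hmU, hm, hm0, hmG, hmext⟩ := hG
  obtain ⟨c, rfl⟩ := hlext m hmU (fun v hv => (hmG v).mp (h hv))
  have hc : c ≠ 0 := by
    rintro rfl
    simp at hm0
  ext v
  simp [hlF, hmG, hc]

/-- An affine dependence: a set larger than the dimension of the space of functions on it. -/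
lemma exists_dependence {V : Type*} [Finite V] (U : Submodule ℝ (V → ℝ)) (F : Finset V)
    (h : Module.finrank ℝ U < F.card + Module.finrank ℝ (vanishingOn U F)) :
    ∃ c : V → ℝ, (∃ v ∈ F, c v ≠ 0) ∧ ∀ g ∈ U, ∑ v ∈ F, c v * g v = 0 := by
  classical
  have h1 := finrank_range_restrictTo_add U F
  have hlt : LinearMap.range (restrictTo U F) < ⊤ := by
    refine lt_top_iff_ne_top.mpr fun htop => ?_
    rw [htop] at h1
    simp only [finrank_top, Module.finrank_fintype_fun_eq_card, Fintype.card_coe] at h1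
    omega
  obtain ⟨ψ, hψ, hle⟩ := Submodule.exists_le_ker_of_lt_top _ hlt
  refine ⟨fun v => if hv : v ∈ F then ψ (Pi.single ⟨v, hv⟩ 1) else 0, ?_, fun g hg => ?_⟩
  · by_contra! hcon
    refine hψ (LinearMap.pi_ext' fun i => LinearMap.ext_ring ?_)
    have := hcon i i.2
    simpa using this
  · have h5 : ψ (restrictTo U F ⟨g, hg⟩) = 0 := hle (LinearMap.mem_range_self (restrictTo U F) _)
    rw [LinearMap.pi_apply_eq_sum_univ] at h5
    rw [← h5, ← Finset.sum_coe_sort F]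
    refine Finset.sum_congr rfl fun v _ => ?_
    simp only [Finset.coe_mem, dif_pos, smul_eq_mul]
    rw [mul_comm]
    congr 2
    ext w
    simp [Pi.single_apply, eq_comm]

/-- Every pair of points is the zero set of a nonnegative function in `U`. -/
def PairsExposed {V : Type*} (U : Submodule ℝ (V → ℝ)) : Prop :=
  ∀ u w, u ≠ w → ∃ e ∈ U, (∀ v, 0 ≤ e v) ∧ ∀ v, e v = 0 ↔ v = u ∨ v = w

open Classical in
lemma exists_zeroSet_disjoint {V : Type*} [Fintype V] (U : Submodule ℝ (V → ℝ))
    (hone : (1 : V → ℝ) ∈ U) (hpairs : PairsExposed U) (F : Finset V)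
    (hF : IsExtremeZeroSet U F) (hcard : 3 ≤ Fᶜ.card) :
    ∃ y ∈ U, (∀ v, 0 ≤ y v) ∧ (∀ v ∈ F, y v ≠ 0) ∧
      3 ≤ (Finset.univ.filter (fun v => y v = 0)).card := by
  obtain ⟨l, hlU, hl, hl0, hlF, -⟩ := hF
  obtain ⟨x, hx, hmin⟩ := Fᶜ.exists_min_image l (Finset.card_pos.mp (by omega))
  have hxF : x ∉ F := by simpa using hx
  have hlx : 0 < l x := lt_of_le_of_ne (hl x) (fun h => hxF ((hlF x).mpr h.symm))
  set h : V → ℝ := l - l x • 1 with hh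
  have hhU : h ∈ U := U.sub_mem hlU (U.smul_mem _ hone)
  have hhv : ∀ v, h v = l v - l x := fun v => by simp [hh]
  have hhF : ∀ v ∈ F, h v < 0 := fun v hv => by rw [hhv, (hlF v).mp hv]; linarith
  have hhW : ∀ v, v ∉ F → 0 ≤ h v := fun v hv => by
    rw [hhv]
    linarith [hmin v (by simpa using hv)]
  have hhx : h x = 0 := by rw [hhv, sub_self]
  by_cases hex : ∃ u, 0 < h u
  · obtain ⟨u, hu⟩ := hex
    have hux : u ≠ x := by
      rintro rfl
      exact hu.ne' hhx
    obtain ⟨w, hwF, hw⟩ := Finset.exists_mem_notMem_of_card_lt_card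
      (s := {x, u}) (t := Fᶜ) (lt_of_le_of_lt Finset.card_le_two (by omega))
    rw [Finset.mem_compl] at hwF
    simp only [Finset.mem_insert, Finset.mem_singleton, not_or] at hw
    obtain ⟨e, heU, he, heZ⟩ := hpairs x u hux.symm
    obtain ⟨e', heU', he', heZ'⟩ := hpairs x w (Ne.symm hw.1)
    have hew : 0 < e w := lt_of_le_of_ne (he w) (fun h => by
      rcases (heZ w).mp h.symm with h | h
      exacts [hw.1 h, hw.2 h])
    have hc : 0 ≤ h w / e w := div_nonneg (hhW w hwF) hew.le
    set k : V → ℝ := h - (h w / e w) • e with hk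
    have hkU : k ∈ U := U.sub_mem hhU (U.smul_mem _ heU)
    have hkv : ∀ v, k v = h v - (h w / e w) * e v := fun v => by simp [hk]
    have hku : 0 < k u := by
      rw [hkv, (heZ u).mpr (Or.inr rfl)]
      simpa using hu
    have hkx : k x = 0 := by
      rw [hkv, (heZ x).mpr (Or.inl rfl), hhx]
      simp
    have hkw : k w = 0 := by
      rw [hkv, div_mul_cancel₀ _ hew.ne', sub_self]
    have hkF : ∀ v ∈ F, k v < 0 := fun v hv => by
      rw [hkv]
      have := mul_nonneg hc (he v)
      linarith [hhF v hv]
    obtain ⟨t, ht0, ht, z, -, hkz, hz⟩ := exists_sub_mul_nonneg Finset.univ e' k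
      (fun v _ => he' v) ⟨u, Finset.mem_univ u, hku⟩
    refine ⟨e' - t • k, U.sub_mem heU' (U.smul_mem t hkU), fun v => ht v (Finset.mem_univ v),
      fun v hv => ?_, ?_⟩
    · have h1 : 0 < e' v := lt_of_le_of_ne (he' v) (fun h => by
        rcases (heZ' v).mp h.symm with rfl | rfl
        exacts [hxF hv, hwF hv])
      have h2 := mul_nonneg ht0 (neg_nonneg.mpr (hkF v hv).le)
      have : 0 < e' v - t * k v := by linarith
      exact this.ne'
    · have hzx : z ≠ x := fun h => hkz.ne' (h ▸ hkx)
      have hzw : z ≠ w := fun h => hkz.ne' (h ▸ hkw)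
      rw [← Finset.card_eq_three.mpr ⟨x, w, z, Ne.symm hw.1, hzx.symm, hzw.symm, rfl⟩]
      refine Finset.card_le_card fun v hv => ?_
      simp only [Finset.mem_insert, Finset.mem_singleton] at hv
      rcases hv with rfl | rfl | rfl
      · simp [hkx, (heZ' v).mpr (Or.inl rfl)]
      · simp [hkw, (heZ' v).mpr (Or.inr rfl)]
      · simpa using hz
  · push Not at hex
    refine ⟨-h, U.neg_mem hhU, fun v => by simpa using hex v,
      fun v hv => by simpa using (hhF v hv).ne, hcard.trans (Finset.card_le_card fun v hv => ?_)⟩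
    simpa using le_antisymm (hex v) (hhW v (by simpa using hv))

open Classical in
lemma exists_triangle_disjoint {V : Type*} [Fintype V] (U : Submodule ℝ (V → ℝ))
    (hone : (1 : V → ℝ) ∈ U) (hpairs : PairsExposed U) (F : Finset V)
    (hF : IsExtremeZeroSet U F) (hcard : 3 ≤ Fᶜ.card) :
    ∃ y ∈ U, ∃ Z : Finset V, (∀ v, 0 ≤ y v) ∧ (∀ v, v ∈ Z ↔ y v = 0) ∧ Disjoint Z F ∧
      3 ≤ Z.card ∧ Module.finrank ℝ U ≤ Module.finrank ℝ (vanishingOn U Z) + 3 := by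
  obtain ⟨y₀, hy₀U, hy₀, hy₀F, hy₀c⟩ := exists_zeroSet_disjoint U hone hpairs F hF hcard
  obtain ⟨Z, hZ, hmin⟩ := (Finset.univ.filter (fun Z : Finset V => ∃ y ∈ U, (∀ v, 0 ≤ y v) ∧
      (∀ v, v ∈ Z ↔ y v = 0) ∧ Disjoint Z F ∧ 3 ≤ Z.card)).exists_min_image Finset.card
    ⟨Finset.univ.filter (fun v => y₀ v = 0), by
      simp only [Finset.mem_filter, Finset.mem_univ, true_and]
      exact ⟨y₀, hy₀U, hy₀, by simp, Finset.disjoint_left.mpr fun v hv hvF =>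
        hy₀F v hvF (by simpa using hv), hy₀c⟩⟩
  obtain ⟨y, hyU, hy, hyZ, hZF, hZc⟩ := by
    simpa only [Finset.mem_filter, Finset.mem_univ, true_and] using hZ
  refine ⟨y, hyU, Z, hy, hyZ, hZF, hZc, ?_⟩
  obtain ⟨T, hTZ, hT⟩ := Finset.exists_subset_card_eq hZc
  obtain ⟨a, b, c, hab, hac, hbc, rfl⟩ := Finset.card_eq_three.mp hT
  have hle : vanishingOn U {a, b, c} ≤ vanishingOn U Z := by
    have hpos : ∀ g ∈ vanishingOn U {a, b, c}, ∀ v ∈ Z, g v ≤ 0 := by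
      rintro g ⟨hgU, hg⟩
      have hga := hg a (by simp)
      have hgb := hg b (by simp)
      have hgc := hg c (by simp)
      by_contra! hcon
      obtain ⟨e, heU, he, heZ⟩ := hpairs a b hab
      obtain ⟨t, -, ht, z, hzZ, hgz, hz⟩ := exists_sub_mul_nonneg Z e g (fun v _ => he v) hcon
      obtain ⟨s, hs⟩ := exists_add_mul_pos (Finset.univ.filter (fun v => y v ≠ 0)) (e - t • g) y
        (fun v hv => lt_of_le_of_ne (hy v) (Ne.symm (by simpa using hv)))
      have hval : ∀ v ∈ Z, (e - t • g + s • y) v = e v - t * g v := fun v hv => by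
        simp [(hyZ v).mp hv]
      have hval' : ∀ v, v ∉ Z → 0 < (e - t • g + s • y) v := fun v hv => by
        simpa using hs v (by simpa [hyZ] using hv)
      have hza : z ≠ a := fun h => hgz.ne' (h ▸ hga)
      have hzb : z ≠ b := fun h => hgz.ne' (h ▸ hgb)
      set Z' := Z.filter (fun v => e v - t * g v = 0) with hZ'
      have hcZ' : c ∉ Z' := by
        simp only [hZ', Finset.mem_filter, hgc, mul_zero, sub_zero, heZ]
        rintro ⟨-, h | h⟩
        exacts [hac h.symm, hbc h.symm]
      have hlt : Z'.card < Z.card := Finset.card_lt_card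
        ⟨Finset.filter_subset _ _, fun h => hcZ' (h (hTZ (by simp)))⟩
      refine absurd (hmin Z' ?_) hlt.not_ge
      simp only [Finset.mem_filter, Finset.mem_univ, true_and]
      refine ⟨e - t • g + s • y, U.add_mem (U.sub_mem heU (U.smul_mem t hgU)) (U.smul_mem s hyU),
        fun v => ?_, fun v => ?_, hZF.mono_left (Finset.filter_subset _ _), ?_⟩
      · by_cases hv : v ∈ Z
        · rw [hval v hv]
          exact ht v hv
        · exact (hval' v hv).le
      · by_cases hv : v ∈ Z
        · rw [hval v hv]
          simp [hZ', hv]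
        · simp only [hZ', Finset.mem_filter, hv, false_and, false_iff]
          exact (hval' v hv).ne'
      · rw [← Finset.card_eq_three.mpr ⟨a, b, z, hab, hza.symm, hzb.symm, rfl⟩]
        refine Finset.card_le_card fun v hv => ?_
        simp only [Finset.mem_insert, Finset.mem_singleton] at hv
        rcases hv with rfl | rfl | rfl
        · simp [hZ', hga, hTZ (show v ∈ ({v, b, c} : Finset V) by simp),
            (heZ v).mpr (Or.inl rfl)]
        · simp [hZ', hgb, hTZ (show v ∈ ({a, v, c} : Finset V) by simp),
            (heZ v).mpr (Or.inr rfl)]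
        · simp [hZ', hzZ, hz]
    intro g hg
    refine ⟨hg.1, fun v hv => le_antisymm (hpos g hg v hv) ?_⟩
    simpa using hpos (-g) (Submodule.neg_mem _ hg) v hv
  have h1 := finrank_le_finrank_vanishingOn_add_card U {a, b, c}
  have h2 := Submodule.finrank_mono hle
  omega

open Classical in
lemma card_filter_pair_subset {V : Type*} [Fintype V] (U : Submodule ℝ (V → ℝ))
    (hpairs : PairsExposed U) {u w : V} (huw : u ≠ w) :
    Module.finrank ℝ U ≤ ((extremeZeroSets U).filter ({u, w} ⊆ ·)).card + 2 := by
  obtain ⟨e, heU, he, heZ⟩ := hpairs u w huw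
  have h1 := finrank_vanishingOn_le_card U {u, w} e heU he (by simp [heZ])
  have h2 := finrank_le_finrank_vanishingOn_add_card U {u, w}
  have h3 : ({u, w} : Finset V).card = 2 := Finset.card_pair huw
  omega

open Classical in
lemma exists_adjacent_avoiding {V : Type*} [Fintype V] (U : Submodule ℝ (V → ℝ))
    (hpairs : PairsExposed U) (F : Finset V) (hF : IsExtremeZeroSet U F) {i u w : V}
    (hi : i ∈ F) (hu : u ∈ F) (hw : w ∈ F) (hiu : i ≠ u) (hiw : i ≠ w) (huw : u ≠ w) :
    ∃ G, IsExtremeZeroSet U G ∧ u ∈ G ∧ w ∈ G ∧ i ∉ G ∧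
      Module.finrank ℝ U ≤ (F ∩ G).card + 2 := by
  obtain ⟨e, heU, he, heZ⟩ := hpairs u w huw
  obtain ⟨G, hG, hGZ, hiG, hrank⟩ := exists_adjacent U F hF e heU (fun v _ => he v) i hi
    (lt_of_le_of_ne (he i) (fun h => by
      rcases (heZ i).mp h.symm with h | h
      exacts [hiu h, hiw h]))
  exact ⟨G, hG, hGZ u hu ((heZ u).mpr (Or.inl rfl)), hGZ w hw ((heZ w).mpr (Or.inr rfl)),
    hiG, hrank⟩

open Classical in
lemma card_adjacent_of_card_eq_finrank {V : Type*} [Fintype V] (U : Submodule ℝ (V → ℝ))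
    (hpairs : PairsExposed U) (F : Finset V) (hF : IsExtremeZeroSet U F) {d : ℕ} (hd : 4 ≤ d)
    (hU : Module.finrank ℝ U = d + 1) (hFc : F.card = d + 1) :
    d + 4 ≤ ((extremeZeroSets U).filter (fun G => G ≠ F ∧ d ≤ (F ∩ G).card + 1)).card := by
  set 𝒢 := (extremeZeroSets U).filter (fun G => G ≠ F ∧ d ≤ (F ∩ G).card + 1) with h𝒢
  set 𝒟 := 𝒢.image (F \ ·) with h𝒟
  refine le_trans ?_ (Finset.card_image_le (s := 𝒢) (f := (F \ ·)))
  rw [← h𝒟]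
  have hmem : ∀ D ∈ 𝒟, ∃ G, IsExtremeZeroSet U G ∧ D = F \ G := by
    intro D hD
    obtain ⟨G, hG, rfl⟩ := Finset.mem_image.mp hD
    exact ⟨G, mem_extremeZeroSets.mp (Finset.mem_filter.mp hG).1, rfl⟩
  have hDsub : ∀ D ∈ 𝒟, D ⊆ F := by
    intro D hD
    obtain ⟨G, -, rfl⟩ := hmem D hD
    exact Finset.sdiff_subset
  have hDcard : ∀ D ∈ 𝒟, D.card = 1 ∨ D.card = 2 := by
    intro D hD
    obtain ⟨G, hG, rfl⟩ := Finset.mem_image.mp hD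
    obtain ⟨hGe, hGF, hGc⟩ := Finset.mem_filter.mp hG
    have h1 := Finset.card_sdiff_add_card_inter F G
    have h2 : (F \ G).card ≠ 0 := fun h => by
      rw [Finset.card_eq_zero, Finset.sdiff_eq_empty_iff_subset] at h
      exact hGF (hF.eq_of_subset (mem_extremeZeroSets.mp hGe) h).symm
    omega
  set N : V → Finset V := fun i => (F.erase i).filter (fun j => {i, j} ∈ 𝒟) with hN
  have hNcard : ∀ i ∈ F, {i} ∉ 𝒟 → 3 ≤ (N i).card := by
    intro i hi hi𝒟
    by_contra! hlt
    obtain ⟨T, hNT, hTF, hT⟩ := Finset.exists_subsuperset_card_eq (s := N i) (t := F.erase i)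
      (n := 2) (Finset.filter_subset _ _) (by omega) (by rw [Finset.card_erase_of_mem hi]; omega)
    obtain ⟨u, w, huw, rfl⟩ := Finset.card_eq_two.mp hT
    have hu := Finset.mem_erase.mp (hTF (show u ∈ ({u, w} : Finset V) by simp))
    have hw := Finset.mem_erase.mp (hTF (show w ∈ ({u, w} : Finset V) by simp))
    obtain ⟨G, hG, huG, hwG, hiG, hrank⟩ := exists_adjacent_avoiding U hpairs F hF hi hu.2 hw.2
      hu.1.symm hw.1.symm huw
    have hD : F \ G ∈ 𝒟 := Finset.mem_image_of_mem _ (Finset.mem_filter.mpr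
      ⟨mem_extremeZeroSets.mpr hG, fun h => hiG (h ▸ hi), by omega⟩)
    have hiD : i ∈ F \ G := Finset.mem_sdiff.mpr ⟨hi, hiG⟩
    rcases hDcard _ hD with h | h
    · obtain ⟨j, hj⟩ := Finset.card_eq_one.mp h
      rw [hj, Finset.mem_singleton] at hiD
      rw [hj, ← hiD] at hD
      exact hi𝒟 hD
    · obtain ⟨j, hj⟩ := Finset.card_eq_one.mp
        (show ((F \ G).erase i).card = 1 by rw [Finset.card_erase_of_mem hiD]; omega)
      have hjD : j ∈ (F \ G).erase i := by simp [hj]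
      have hpair : F \ G = {i, j} := by rw [← Finset.insert_erase hiD, hj]
      have hjF := Finset.mem_sdiff.mp (Finset.mem_erase.mp hjD).2
      have : j ∈ N i := Finset.mem_filter.mpr
        ⟨Finset.mem_erase.mpr ⟨(Finset.mem_erase.mp hjD).1, hjF.1⟩, hpair ▸ hD⟩
      have := hNT this
      simp only [Finset.mem_insert, Finset.mem_singleton] at this
      rcases this with rfl | rfl
      exacts [hjF.2 huG, hjF.2 hwG]
  obtain ⟨c, ⟨i₀, hi₀, hci₀⟩, hc⟩ := exists_dependence U F (by
    have : 0 < Module.finrank ℝ (vanishingOn U F) := by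
      obtain ⟨l, hlU, -, hl0, hlF, -⟩ := hF
      exact Module.finrank_pos_iff_exists_ne_zero.mpr
        ⟨⟨l, hlU, fun v hv => (hlF v).mp hv⟩, fun h => hl0 (congrArg Subtype.val h)⟩
    omega)
  have hcD : ∀ D ∈ 𝒟, ∃ y : V → ℝ, (∀ v ∈ D, 0 < y v) ∧ ∑ v ∈ D, c v * y v = 0 := by
    intro D hD
    obtain ⟨G, ⟨y, hyU, hy, -, hyG, -⟩, rfl⟩ := hmem D hD
    refine ⟨y, fun v hv => lt_of_le_of_ne (hy v) (fun h =>
      (Finset.mem_sdiff.mp hv).2 ((hyG v).mpr h.symm)), ?_⟩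
    rw [← hc y hyU]
    refine Finset.sum_subset Finset.sdiff_subset fun v hv hv' => ?_
    have : v ∈ G := by simpa [hv] using hv'
    rw [(hyG v).mp this, mul_zero]
  have hc1 : ∀ i, {i} ∈ 𝒟 → c i = 0 := by
    intro i hi
    obtain ⟨y, hy, hsum⟩ := hcD _ hi
    rw [Finset.sum_singleton] at hsum
    exact (mul_eq_zero.mp hsum).resolve_right (hy i (by simp)).ne'
  have hc2 : ∀ i, ∀ j ∈ N i, (0 < c i → c j < 0) ∧ (c i < 0 → 0 < c j) := by
    intro i j hj
    obtain ⟨hjF, hij⟩ := Finset.mem_filter.mp hj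
    obtain ⟨y, hy, hsum⟩ := hcD _ hij
    rw [Finset.sum_pair (Finset.mem_erase.mp hjF).1.symm] at hsum
    have h1 := hy i (by simp)
    have h2 := hy j (by simp)
    constructor
    · intro h
      by_contra! h'
      nlinarith [mul_pos h h1, mul_nonneg h' h2.le]
    · intro h
      by_contra! h'
      nlinarith [mul_neg_of_neg_of_pos h h1, mul_nonneg (neg_nonneg.mpr h') h2.le]
  have hNF : ∀ i, N i ⊆ F := fun i =>
    (Finset.filter_subset _ _).trans (Finset.erase_subset _ _)
  have hposneg : ∀ i ∈ F, 0 < c i → 3 ≤ (F.filter (fun j => c j < 0)).card := by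
    intro i hi hci
    refine (hNcard i hi (fun h => hci.ne' (hc1 i h))).trans (Finset.card_le_card fun j hj => ?_)
    exact Finset.mem_filter.mpr ⟨hNF i hj, (hc2 i j hj).1 hci⟩
  have hnegpos : ∀ i ∈ F, c i < 0 → 3 ≤ (F.filter (fun j => 0 < c j)).card := by
    intro i hi hci
    refine (hNcard i hi (fun h => hci.ne (hc1 i h))).trans (Finset.card_le_card fun j hj => ?_)
    exact Finset.mem_filter.mpr ⟨hNF i hj, (hc2 i j hj).2 hci⟩
  have hboth : 3 ≤ (F.filter (fun j => 0 < c j)).card ∧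
      3 ≤ (F.filter (fun j => c j < 0)).card := by
    rcases lt_or_gt_of_ne hci₀ with h | h
    · have h1 := hnegpos i₀ hi₀ h
      obtain ⟨j, hj⟩ := Finset.card_pos.mp (lt_of_lt_of_le (by norm_num) h1)
      rw [Finset.mem_filter] at hj
      exact ⟨h1, hposneg j hj.1 hj.2⟩
    · have h1 := hposneg i₀ hi₀ h
      obtain ⟨j, hj⟩ := Finset.card_pos.mp (lt_of_lt_of_le (by norm_num) h1)
      rw [Finset.mem_filter] at hj
      exact ⟨hnegpos j hj.1 hj.2, h1⟩
  have hM : 6 ≤ (F.filter (fun i => {i} ∉ 𝒟)).card := by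
    have hdisj : Disjoint (F.filter (fun j => 0 < c j)) (F.filter (fun j => c j < 0)) :=
      Finset.disjoint_filter.mpr fun j _ h1 h2 => lt_asymm h1 h2
    have hsub : F.filter (fun j => 0 < c j) ∪ F.filter (fun j => c j < 0) ⊆
        F.filter (fun i => {i} ∉ 𝒟) := by
      intro j hj
      simp only [Finset.mem_union, Finset.mem_filter] at hj ⊢
      rcases hj with h | h
      · exact ⟨h.1, fun h' => h.2.ne' (hc1 j h')⟩
      · exact ⟨h.1, fun h' => h.2.ne (hc1 j h')⟩
    have := Finset.card_le_card hsub
    rw [Finset.card_union_of_disjoint hdisj] at this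
    omega
  have hcount : ∑ i ∈ F, ∑ D ∈ 𝒟 with i ∈ D, (if D.card = 1 then 2 else 1) = 2 * 𝒟.card := by
    rw [Finset.sum_comm' (t' := 𝒟) (s' := fun D => D) (by
      intro i D
      simp only [Finset.mem_filter]
      exact ⟨fun h => ⟨h.2.2, h.2.1⟩, fun h => ⟨hDsub D h.2 h.1, h.2, h.1⟩⟩)]
    rw [Finset.sum_congr rfl (g := fun _ => 2), Finset.sum_const, smul_eq_mul, mul_comm]
    intro D hD
    rw [Finset.sum_const, smul_eq_mul]
    rcases hDcard D hD with h | h <;> simp [h]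
  have hlow : ∀ i ∈ F, 2 + (if {i} ∉ 𝒟 then 1 else 0) ≤
      ∑ D ∈ 𝒟 with i ∈ D, (if D.card = 1 then 2 else 1) := by
    intro i hi
    by_cases h : {i} ∈ 𝒟
    · rw [if_neg (not_not.mpr h)]
      refine le_trans ?_ (Finset.single_le_sum (f := fun D : Finset V => if D.card = 1 then 2 else 1)
        (fun _ _ => Nat.zero_le _) (Finset.mem_filter.mpr ⟨h, Finset.mem_singleton_self i⟩))
      simp
    · rw [if_pos h]
      calc 2 + 1 ≤ (N i).card := hNcard i hi h
        _ ≤ (𝒟.filter (i ∈ ·)).card := by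
          refine Finset.card_le_card_of_injOn (fun j => {i, j})
            (fun j hj => ?_) (fun j hj k hk hjk => ?_)
          · simpa using (Finset.mem_filter.mp hj).2
          · have hj' := (Finset.mem_erase.mp (Finset.mem_filter.mp hj).1).1
            have : j ∈ ({i, k} : Finset V) := by
              rw [← show ({i, j} : Finset V) = {i, k} from hjk]
              simp
            simpa [hj'] using this
        _ = ∑ D ∈ 𝒟 with i ∈ D, 1 := by simp
        _ ≤ _ := Finset.sum_le_sum fun D _ => by split_ifs <;> norm_num
  have hsum := Finset.sum_le_sum hlow
  rw [hcount, Finset.sum_add_distrib, Finset.sum_const, smul_eq_mul, ← Finset.card_filter] at hsum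
  omega

open Classical in
lemma card_extremeZeroSets_of_nonsimplex {V : Type*} [Fintype V] (U : Submodule ℝ (V → ℝ))
    (hone : (1 : V → ℝ) ∈ U) (hpairs : PairsExposed U) {d : ℕ} (hd : 4 ≤ d)
    (hU : Module.finrank ℝ U = d + 1) (hV : d + 4 ≤ Fintype.card V)
    (hcard : ∀ F, IsExtremeZeroSet U F → F.card ≤ d + 1)
    (F : Finset V) (hF : IsExtremeZeroSet U F) (hFc : F.card = d + 1) :
    2 * d + 3 ≤ (extremeZeroSets U).card := by
  have h1 := card_adjacent_of_card_eq_finrank U hpairs F hF hd hU hFc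
  obtain ⟨y, hyU, Z, hy, hyZ, hZF, hZc, hrank⟩ := exists_triangle_disjoint U hone hpairs F hF
    (by rw [Finset.card_compl]; omega)
  have h2 := finrank_vanishingOn_le_card U Z y hyU hy hyZ
  set 𝒢 := (extremeZeroSets U).filter (fun G => G ≠ F ∧ d ≤ (F ∩ G).card + 1)
  set 𝒯 := (extremeZeroSets U).filter (Z ⊆ ·)
  have hdisj : Disjoint 𝒢 𝒯 := by
    refine Finset.disjoint_left.mpr fun G hG hG' => ?_
    obtain ⟨hGe, -, hFG⟩ := Finset.mem_filter.mp hG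
    have hZG := (Finset.mem_filter.mp hG').2
    have h3 := hcard G (mem_extremeZeroSets.mp hGe)
    have h4 : Disjoint Z (F ∩ G) := hZF.mono_right Finset.inter_subset_left
    have h5 := Finset.card_le_card (Finset.union_subset hZG (Finset.inter_subset_right (s₁ := F)))
    rw [Finset.card_union_of_disjoint h4] at h5
    omega
  have hFn : F ∉ 𝒢 ∪ 𝒯 := by
    intro h
    rcases Finset.mem_union.mp h with h | h
    · exact (Finset.mem_filter.mp h).2.1 rfl
    · have hZ : Z = ∅ := by
        have := (Finset.mem_filter.mp h).2
        exact Finset.disjoint_self_iff_empty Z |>.mp (hZF.mono_right this)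
      simp [hZ] at hZc
  have hsub : insert F (𝒢 ∪ 𝒯) ⊆ extremeZeroSets U :=
    Finset.insert_subset (mem_extremeZeroSets.mpr hF)
      (Finset.union_subset (Finset.filter_subset _ _) (Finset.filter_subset _ _))
  have h6 := Finset.card_le_card hsub
  rw [Finset.card_insert_of_notMem hFn, Finset.card_union_of_disjoint hdisj] at h6
  omega

open Classical in
lemma card_adjacent_of_simplicial {V : Type*} [Fintype V] (U : Submodule ℝ (V → ℝ))
    (hpairs : PairsExposed U) {d : ℕ} (hd : 4 ≤ d)
    (hU : Module.finrank ℝ U = d + 1)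
    (hcard : ∀ F, IsExtremeZeroSet U F → F.card = d)
    (F : Finset V) (hF : IsExtremeZeroSet U F) :
    d ≤ ((extremeZeroSets U).filter (fun G => (F ∩ G).card + 1 = d)).card := by
  have hex : ∀ p ∈ F, ∃ G, IsExtremeZeroSet U G ∧ F ∩ G = F.erase p := by
    intro p hp
    obtain ⟨T, hTF, hT⟩ := Finset.exists_subset_card_eq (s := F.erase p) (n := 2)
      (by rw [Finset.card_erase_of_mem hp, hcard F hF]; omega)
    obtain ⟨u, w, huw, rfl⟩ := Finset.card_eq_two.mp hT
    have hu := Finset.mem_erase.mp (hTF (show u ∈ ({u, w} : Finset V) by simp))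
    have hw := Finset.mem_erase.mp (hTF (show w ∈ ({u, w} : Finset V) by simp))
    obtain ⟨G, hG, -, -, hpG, hrank⟩ := exists_adjacent_avoiding U hpairs F hF hp hu.2 hw.2
      hu.1.symm hw.1.symm huw
    refine ⟨G, hG, Finset.eq_of_subset_of_card_le (fun v hv => ?_) ?_⟩
    · rw [Finset.mem_inter] at hv
      exact Finset.mem_erase.mpr ⟨fun h => hpG (h ▸ hv.2), hv.1⟩
    · rw [Finset.card_erase_of_mem hp, hcard F hF]
      omega
  choose! A hA hFA using hex
  conv_lhs => rw [← hcard F hF]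
  refine Finset.card_le_card_of_injOn A (fun p hp => ?_) (fun p hp q hq hpq => ?_)
  · have hp' : p ∈ F := hp
    simp only [Finset.coe_filter, Set.mem_ofPred_eq, mem_extremeZeroSets]
    refine ⟨hA p hp', ?_⟩
    rw [hFA p hp', Finset.card_erase_of_mem hp', hcard F hF]
    omega
  · by_contra hne
    have h1 : p ∈ F.erase q := Finset.mem_erase.mpr ⟨hne, hp⟩
    rw [← hFA q hq, ← hpq, hFA p hp] at h1
    exact (Finset.mem_erase.mp h1).1 rfl

open Classical in
lemma card_extremeZeroSets_of_simplicial {V : Type*} [Fintype V] (U : Submodule ℝ (V → ℝ))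
    (hpairs : PairsExposed U) {d : ℕ} (hd : 4 ≤ d)
    (hU : Module.finrank ℝ U = d + 1) (hV : d + 4 ≤ Fintype.card V)
    (hcard : ∀ F, IsExtremeZeroSet U F → F.card = d)
    (F : Finset V) (hF : IsExtremeZeroSet U F) :
    2 * d + 3 ≤ (extremeZeroSets U).card := by
  set N : Finset V → Finset (Finset V) :=
    fun F => (extremeZeroSets U).filter (fun G => (F ∩ G).card + 1 = d) with hN
  have hNd : ∀ F, IsExtremeZeroSet U F → d ≤ (N F).card := fun F hF =>
    card_adjacent_of_simplicial U hpairs hd hU hcard F hF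
  have hNe : ∀ F, ∀ G ∈ N F, IsExtremeZeroSet U G := fun F G hG =>
    mem_extremeZeroSets.mp (Finset.mem_filter.mp hG).1
  have hNs : ∀ F, ∀ G ∈ N F, (G \ F).card = 1 := fun F G hG => by
    have h1 := (Finset.mem_filter.mp hG).2
    have h2 := Finset.card_sdiff_add_card_inter G F
    rw [hcard G (hNe F G hG), Finset.inter_comm] at h2
    omega
  have hNself : ∀ F, F ∉ N F := fun F hF => by
    have := hNs F F hF
    simp at this
  have hNsub : ∀ F, N F ⊆ extremeZeroSets U := fun F => Finset.filter_subset _ _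
  have hpair := fun (u w : V) (huw : u ≠ w) => card_filter_pair_subset U hpairs huw
  have hFmem := mem_extremeZeroSets.mpr hF
  by_cases hH : ∃ H, IsExtremeZeroSet U H ∧ 3 ≤ (H \ F).card
  · obtain ⟨H, hHe, hHF⟩ := hH
    have hFH : 3 ≤ (F \ H).card := by
      have h1 := Finset.card_sdiff_add_card_inter H F
      have h2 := Finset.card_sdiff_add_card_inter F H
      rw [hcard H hHe] at h1
      rw [hcard F hF, Finset.inter_comm] at h2
      omega
    have hNH : ∀ G ∈ insert H (N H), 2 ≤ (G \ F).card := by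
      intro G hG
      have h1 : (H \ G).card ≤ 1 := by
        rcases Finset.mem_insert.mp hG with rfl | hG
        · simp
        · have h3 := (Finset.mem_filter.mp hG).2
          have h2 := Finset.card_sdiff_add_card_inter H G
          rw [hcard H hHe] at h2
          omega
      have h2 : H \ F ⊆ (G \ F) ∪ (H \ G) := by
        intro v hv
        simp only [Finset.mem_union, Finset.mem_sdiff] at hv ⊢
        tauto
      have := (Finset.card_le_card h2).trans (Finset.card_union_le _ _)
      omega
    have hNF : ∀ G ∈ insert F (N F), (G \ F).card ≤ 1 := by
      intro G hG
      rcases Finset.mem_insert.mp hG with rfl | hG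
      · simp
      · exact (hNs F G hG).le
    have hdisj : Disjoint (insert F (N F)) (insert H (N H)) :=
      Finset.disjoint_left.mpr fun G h1 h2 => by
        have := hNF G h1
        have := hNH G h2
        omega
    have hsub : insert F (N F) ∪ insert H (N H) ⊆ extremeZeroSets U :=
      Finset.union_subset (Finset.insert_subset hFmem (hNsub F))
        (Finset.insert_subset (mem_extremeZeroSets.mpr hHe) (hNsub H))
    have hunion : (insert F (N F) ∪ insert H (N H)).card =
        ((N F).card + 1) + ((N H).card + 1) := by
      rw [Finset.card_union_of_disjoint hdisj, Finset.card_insert_of_notMem (hNself F),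
        Finset.card_insert_of_notMem (hNself H)]
    by_contra! hlt
    have h1 := hNd F hF
    have h2 := hNd H hHe
    have heq := Finset.eq_of_subset_of_card_le hsub (by omega)
    have hmem : ∀ u ∈ H \ F, ∀ p ∈ F \ H, ∀ G ∈ (extremeZeroSets U).filter ({u, p} ⊆ ·),
        u ∈ G ∧ p ∈ G ∧ (G ∈ N F ∨ G ∈ N H) := by
      intro u hu p hp G hG
      obtain ⟨hGe, hupG⟩ := Finset.mem_filter.mp hG
      have huG : u ∈ G := hupG (by simp)
      have hpG : p ∈ G := hupG (by simp)
      refine ⟨huG, hpG, ?_⟩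
      rw [← heq] at hGe
      simp only [Finset.mem_union, Finset.mem_insert] at hGe
      rw [Finset.mem_sdiff] at hu hp
      rcases hGe with (rfl | h) | (rfl | h)
      · exact absurd huG hu.2
      · exact Or.inl h
      · exact absurd hpG hp.2
      · exact Or.inr h
    have hdisj' : ∀ u ∈ H \ F, ∀ u' ∈ H \ F, ∀ p ∈ F \ H, ∀ p' ∈ F \ H, u ≠ u' → p ≠ p' →
        Disjoint ((extremeZeroSets U).filter ({u, p} ⊆ ·))
          ((extremeZeroSets U).filter ({u', p'} ⊆ ·)) := by
      intro u hu u' hu' p hp p' hp' huu hpp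
      refine Finset.disjoint_left.mpr fun G hG hG' => ?_
      obtain ⟨huG, hpG, hor⟩ := hmem u hu p hp G hG
      obtain ⟨huG', hpG', -⟩ := hmem u' hu' p' hp' G hG'
      rw [Finset.mem_sdiff] at hu hu' hp hp'
      rcases hor with h | h
      · exact huu (Finset.card_le_one.mp (hNs F G h).le u (Finset.mem_sdiff.mpr ⟨huG, hu.2⟩) u'
          (Finset.mem_sdiff.mpr ⟨huG', hu'.2⟩))
      · exact hpp (Finset.card_le_one.mp (hNs H G h).le p (Finset.mem_sdiff.mpr ⟨hpG, hp.2⟩) p'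
          (Finset.mem_sdiff.mpr ⟨hpG', hp'.2⟩))
    have hne : ∀ u ∈ H \ F, ∀ p ∈ F \ H, u ≠ p := fun u hu p hp h =>
      (Finset.mem_sdiff.mp hu).2 (h ▸ (Finset.mem_sdiff.mp hp).1)
    obtain ⟨u₁, u₂, u₃, hu₁, hu₂, hu₃, hu₁₂, hu₁₃, hu₂₃⟩ := Finset.two_lt_card_iff.mp hHF
    obtain ⟨p₁, p₂, p₃, hp₁, hp₂, hp₃, hp₁₂, hp₁₃, hp₂₃⟩ := Finset.two_lt_card_iff.mp hFH
    have d₁₂ := hdisj' u₁ hu₁ u₂ hu₂ p₁ hp₁ p₂ hp₂ hu₁₂ hp₁₂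
    have d₁₃ := hdisj' u₁ hu₁ u₃ hu₃ p₁ hp₁ p₃ hp₃ hu₁₃ hp₁₃
    have d₂₃ := hdisj' u₂ hu₂ u₃ hu₃ p₂ hp₂ p₃ hp₃ hu₂₃ hp₂₃
    have e₁ := hpair u₁ p₁ (hne u₁ hu₁ p₁ hp₁)
    have e₂ := hpair u₂ p₂ (hne u₂ hu₂ p₂ hp₂)
    have e₃ := hpair u₃ p₃ (hne u₃ hu₃ p₃ hp₃)
    set A₁ := (extremeZeroSets U).filter ({u₁, p₁} ⊆ ·)
    set A₂ := (extremeZeroSets U).filter ({u₂, p₂} ⊆ ·)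
    set A₃ := (extremeZeroSets U).filter ({u₃, p₃} ⊆ ·)
    have hsub' : A₁ ∪ A₂ ∪ A₃ ⊆ N F ∪ N H := by
      refine Finset.union_subset (Finset.union_subset ?_ ?_) ?_
      · exact fun G hG => Finset.mem_union.mpr (hmem u₁ hu₁ p₁ hp₁ G hG).2.2
      · exact fun G hG => Finset.mem_union.mpr (hmem u₂ hu₂ p₂ hp₂ G hG).2.2
      · exact fun G hG => Finset.mem_union.mpr (hmem u₃ hu₃ p₃ hp₃ G hG).2.2
    have h3 := (Finset.card_le_card hsub').trans (Finset.card_union_le _ _)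
    rw [Finset.card_union_of_disjoint (Finset.disjoint_union_left.mpr ⟨d₁₃, d₂₃⟩),
      Finset.card_union_of_disjoint d₁₂] at h3
    have h4 := Finset.card_le_card hsub
    omega
  · push Not at hH
    obtain ⟨u, w, x, hu, hw, hx, huw, hux, hwx⟩ := Finset.two_lt_card_iff.mp
      (show 2 < Fᶜ.card by rw [Finset.card_compl, hcard F hF]; omega)
    rw [Finset.mem_compl] at hu hw hx
    have e₁ := hpair u w huw
    have e₂ := hpair u x hux
    set A₁ := (extremeZeroSets U).filter ({u, w} ⊆ ·) with hA₁
    set A₂ := (extremeZeroSets U).filter ({u, x} ⊆ ·) with hA₂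
    have hd₁ : Disjoint A₁ A₂ := Finset.disjoint_left.mpr fun G h1 h2 => by
      simp only [hA₁, hA₂, Finset.mem_filter, Finset.insert_subset_iff,
        Finset.singleton_subset_iff, mem_extremeZeroSets] at h1 h2
      refine absurd (hH G h1.1) (not_lt.mpr (Finset.two_lt_card_iff.mpr
        ⟨u, w, x, ?_, ?_, ?_, huw, hux, hwx⟩)) <;> simp [*]
    have hd₂ : Disjoint (insert F (N F)) (A₁ ∪ A₂) :=
      Finset.disjoint_left.mpr fun G h1 h2 => by
        have hle : (G \ F).card ≤ 1 := by
          rcases Finset.mem_insert.mp h1 with rfl | h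
          · simp
          · exact (hNs F G h).le
        simp only [hA₁, hA₂, Finset.mem_union, Finset.mem_filter, Finset.insert_subset_iff,
          Finset.singleton_subset_iff] at h2
        rcases h2 with ⟨-, h2, h3⟩ | ⟨-, h2, h3⟩
        · exact huw (Finset.card_le_one.mp hle u (Finset.mem_sdiff.mpr ⟨h2, hu⟩) w
            (Finset.mem_sdiff.mpr ⟨h3, hw⟩))
        · exact hux (Finset.card_le_one.mp hle u (Finset.mem_sdiff.mpr ⟨h2, hu⟩) x
            (Finset.mem_sdiff.mpr ⟨h3, hx⟩))
    have hsub : insert F (N F) ∪ (A₁ ∪ A₂) ⊆ extremeZeroSets U :=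
      Finset.union_subset (Finset.insert_subset hFmem (hNsub F))
        (Finset.union_subset (Finset.filter_subset _ _) (Finset.filter_subset _ _))
    have h1 := Finset.card_le_card hsub
    have h2 := hNd F hF
    rw [Finset.card_union_of_disjoint hd₂, Finset.card_union_of_disjoint hd₁,
      Finset.card_insert_of_notMem (hNself F)] at h1
    omega

lemma card_extremeZeroSets_ge {V : Type*} [Fintype V] (U : Submodule ℝ (V → ℝ))
    (hone : (1 : V → ℝ) ∈ U) (hpairs : PairsExposed U) {d : ℕ} (hd : 4 ≤ d)
    (hU : Module.finrank ℝ U = d + 1) (hV : d + 4 ≤ Fintype.card V)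
    (hcard : ∀ F, IsExtremeZeroSet U F → F.card ≤ d + 1) :
    2 * d + 3 ≤ (extremeZeroSets U).card := by
  classical
  by_cases hF : ∃ F, IsExtremeZeroSet U F ∧ F.card = d + 1
  · obtain ⟨F, hF, hFc⟩ := hF
    exact card_extremeZeroSets_of_nonsimplex U hone hpairs hd hU hV hcard F hF hFc
  · push Not at hF
    have hcard' : ∀ F, IsExtremeZeroSet U F → F.card = d := fun F hFe => by
      have h1 := hcard F hFe
      have h2 := hF F hFe
      have h3 := hFe.finrank_le_card_add_one
      omega
    obtain ⟨u, w, huw⟩ := Fintype.exists_pair_of_one_lt_card (show 1 < Fintype.card V by omega)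
    have h1 := card_filter_pair_subset U hpairs huw
    obtain ⟨F, hF⟩ := Finset.card_pos.mp
      (show 0 < ((extremeZeroSets U).filter ({u, w} ⊆ ·)).card by omega)
    exact card_extremeZeroSets_of_simplicial U hpairs hd hU hV hcard' F
      (mem_extremeZeroSets.mp (Finset.mem_filter.mp hF).1)

lemma forall_mem_convexHull_le {N : ℕ} {S : Set (Fin N → ℝ)} {l : (Fin N → ℝ) →ₗ[ℝ] ℝ} {c : ℝ}
    (h : ∀ s ∈ S, l s ≤ c) {x : Fin N → ℝ} (hx : x ∈ convexHull ℝ S) : l x ≤ c :=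
  convexHull_min (t := {x | l x ≤ c}) h (convex_halfSpace_le l.isLinear c) hx

/-- The part of `convexHull S` where a linear functional attains an upper bound is the convex
hull of the points of `S` where it does. -/
lemma sep_convexHull_eq {N : ℕ} (S : Finset (Fin N → ℝ)) {l : (Fin N → ℝ) →ₗ[ℝ] ℝ} {c : ℝ}
    (h : ∀ s ∈ S, l s ≤ c) :
    {x ∈ convexHull ℝ (S : Set (Fin N → ℝ)) | l x = c} =
      convexHull ℝ {s | s ∈ S ∧ l s = c} := by
  apply Set.Subset.antisymm
  · rintro x ⟨hx, hlx⟩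
    obtain ⟨w, hw0, hw1, hwx⟩ := Finset.mem_convexHull'.1 hx
    have hzero : ∀ s ∈ S, w s * (c - l s) = 0 := by
      refine (Finset.sum_eq_zero_iff_of_nonneg fun s hs =>
        mul_nonneg (hw0 s hs) (sub_nonneg.2 (h s hs))).1 ?_
      have hl : l x = ∑ s ∈ S, w s * l s := by
        rw [← hwx, map_sum]
        simp
      simp only [mul_sub, Finset.sum_sub_distrib, ← Finset.sum_mul, hw1, ← hl, hlx]
      ring
    have hsupp : ∀ s ∈ S, w s ≠ 0 → l s = c := fun s hs hws => by
      have := (mul_eq_zero.1 (hzero s hs)).resolve_left hws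
      linarith
    classical
    have h1 : ∑ s ∈ S.filter (fun s => l s = c), w s = 1 := by
      rw [Finset.sum_filter_of_ne hsupp, hw1]
    have hx' : ∑ s ∈ S.filter (fun s => l s = c), w s • s = x := by
      rw [Finset.sum_filter_of_ne fun s hs hne => hsupp s hs (left_ne_zero_of_smul hne), hwx]
    rw [← hx']
    refine (convex_convexHull ℝ _).sum_mem (fun s hs => hw0 s (Finset.mem_filter.1 hs).1) h1
      fun s hs => subset_convexHull ℝ _ (Finset.mem_filter.1 hs)
  · exact convexHull_min (fun s hs => ⟨subset_convexHull ℝ _ hs.1, hs.2⟩)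
      ((convex_convexHull ℝ _).inter (convex_hyperplane l.isLinear c))

lemma isExposed_convexHull_sep {N : ℕ} (S : Finset (Fin N → ℝ)) {l : (Fin N → ℝ) →ₗ[ℝ] ℝ} {c : ℝ}
    (h : ∀ s ∈ S, l s ≤ c) :
    IsExposed ℝ (convexHull ℝ (S : Set (Fin N → ℝ))) (convexHull ℝ {s | s ∈ S ∧ l s = c}) := by
  rintro hne
  obtain ⟨s, hs, hsc⟩ := convexHull_nonempty_iff.1 hne
  refine ⟨LinearMap.toContinuousLinearMap l, ?_⟩
  rw [← sep_convexHull_eq S h]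
  ext x
  simp only [mem_ofPred_eq, LinearMap.coe_toContinuousLinearMap']
  refine and_congr_right fun hx => ⟨fun hxc y hy => ?_, fun hmax => ?_⟩
  · exact hxc ▸ forall_mem_convexHull_le h hy
  · exact le_antisymm (forall_mem_convexHull_le h hx)
      (hsc ▸ hmax s (subset_convexHull ℝ _ hs))

lemma IsExposed.exists_linearMap {N : ℕ} {P B : Set (Fin N → ℝ)} (hB : IsExposed ℝ P B)
    (hne : B.Nonempty) :
    ∃ (l : (Fin N → ℝ) →ₗ[ℝ] ℝ) (c : ℝ), (∀ x ∈ P, l x ≤ c) ∧ B = {x ∈ P | l x = c} := by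
  obtain ⟨l, rfl⟩ := hB hne
  obtain ⟨b, hb, hmax⟩ := hne
  refine ⟨l, l b, hmax, ?_⟩
  ext x
  exact and_congr_right fun hx => ⟨fun h => le_antisymm (hmax x hx) (h b hb),
    fun h y hy => (hmax y hy).trans_eq h.symm⟩

lemma IsExposed.eq_convexHull_inter {N : ℕ} {S : Finset (Fin N → ℝ)} {B : Set (Fin N → ℝ)}
    (hB : IsExposed ℝ (convexHull ℝ (S : Set (Fin N → ℝ))) B) :
    B = convexHull ℝ {s | s ∈ S ∧ s ∈ B} := by
  rcases B.eq_empty_or_nonempty with rfl | hne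
  · simp
  obtain ⟨l, c, hle, rfl⟩ := hB.exists_linearMap hne
  have h : ∀ s ∈ S, l s ≤ c := fun s hs => hle s (subset_convexHull ℝ _ hs)
  conv_lhs => rw [sep_convexHull_eq S h]
  congr 1
  ext s
  exact and_congr_right fun hs => ⟨fun h => ⟨subset_convexHull ℝ _ hs, h⟩, fun h => h.2⟩

lemma vertexSet_convexHull_subset {N : ℕ} (S : Set (Fin N → ℝ)) (hS : S.Finite) :
    vertexSet (convexHull ℝ S) ⊆ S := by
  intro v hv
  lift S to Finset (Fin N → ℝ) using hS
  have h : ({v} : Set (Fin N → ℝ)) = convexHull ℝ {s | s ∈ S ∧ s ∈ ({v} : Set _)} :=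
    IsExposed.eq_convexHull_inter hv
  obtain ⟨s, hs, hsv⟩ := convexHull_nonempty_iff.1 (h ▸ singleton_nonempty v)
  rw [mem_singleton_iff] at hsv
  exact hsv ▸ hs

lemma IsPolytope.exists_eq_convexHull_vertexSet {N : ℕ} {P : Set (Fin N → ℝ)} (hP : IsPolytope P) :
    ∃ S : Finset (Fin N → ℝ), P = convexHull ℝ (S : Set (Fin N → ℝ)) ∧ vertexSet P = S := by
  classical
  have hmin : ∃ S : Finset (Fin N → ℝ), P = convexHull ℝ (S : Set (Fin N → ℝ)) ∧
      ∀ T : Finset (Fin N → ℝ), P = convexHull ℝ (T : Set (Fin N → ℝ)) → S.card ≤ T.card := by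
    have hn : ∃ n, ∃ S : Finset (Fin N → ℝ), P = convexHull ℝ (S : Set (Fin N → ℝ)) ∧
        S.card = n := by
      obtain ⟨S, hS⟩ := hP
      exact ⟨S.card, S, hS, rfl⟩
    obtain ⟨S, hS, hcard⟩ := Nat.find_spec hn
    exact ⟨S, hS, fun T hT => hcard ▸ Nat.find_min' hn ⟨T, hT, rfl⟩⟩
  obtain ⟨S, rfl, hS⟩ := hmin
  refine ⟨S, rfl, Set.Subset.antisymm (vertexSet_convexHull_subset _ S.finite_toSet) fun s hs => ?_⟩
  have hnot : s ∉ convexHull ℝ ((S.erase s : Finset _) : Set (Fin N → ℝ)) := by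
    intro hmem
    have := hS (S.erase s) (Set.Subset.antisymm
      (convexHull_min (fun t ht => ?_) (convex_convexHull ℝ _))
      (convexHull_mono (Finset.coe_subset.2 (S.erase_subset s))))
    · have := Finset.card_erase_lt_of_mem hs
      omega
    · by_cases hts : t = s
      · exact hts ▸ hmem
      · exact subset_convexHull ℝ _ (Finset.mem_coe.2 (Finset.mem_erase.2 ⟨hts, ht⟩))
  obtain ⟨f, u, hlt, hu⟩ := geometric_hahn_banach_closed_point (convex_convexHull ℝ _)
    ((S.erase s).finite_toSet.isClosed_convexHull ℝ) hnot
  have hf : ∀ t ∈ S, t ≠ s → f t < f s := fun t ht hts =>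
    (hlt t (subset_convexHull ℝ _ (Finset.mem_coe.2 (Finset.mem_erase.2 ⟨hts, ht⟩)))).trans hu
  have hexp := isExposed_convexHull_sep S (l := (f : (Fin N → ℝ) →ₗ[ℝ] ℝ)) (c := f s)
    fun t ht => by
      by_cases hts : t = s
      · rw [hts]; rfl
      · exact (hf t ht hts).le
  have hset : {t | t ∈ S ∧ (f : (Fin N → ℝ) →ₗ[ℝ] ℝ) t = f s} = {s} := by
    ext t
    refine ⟨fun ht => ?_, fun ht => ?_⟩
    · by_contra hts
      exact (hf t ht.1 hts).ne ht.2
    · rw [mem_singleton_iff] at ht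
      subst ht
      exact ⟨hs, rfl⟩
  rw [hset, convexHull_singleton] at hexp
  exact hexp

/-- Restrictions of affine functions to a family of points. -/
noncomputable def affineEval {N : ℕ} {ι : Type*} (p : ι → Fin N → ℝ) :
    ((Fin N → ℝ) →ₗ[ℝ] ℝ) × ℝ →ₗ[ℝ] (ι → ℝ) where
  toFun a i := a.1 (p i) + a.2
  map_add' a b := by
    ext i
    simp
    ring
  map_smul' c a := by
    ext i
    simp
    ring

lemma affineEval_apply {N : ℕ} {ι : Type*} (p : ι → Fin N → ℝ) (l : (Fin N → ℝ) →ₗ[ℝ] ℝ) (c : ℝ)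
    (i : ι) : affineEval p (l, c) i = l (p i) + c := rfl

lemma finrank_range_affineEval {N : ℕ} {ι : Type*} [Nonempty ι] (p : ι → Fin N → ℝ) :
    Module.finrank ℝ (LinearMap.range (affineEval p)) =
      Module.finrank ℝ (vectorSpan ℝ (range p)) + 1 := by
  obtain ⟨i₀⟩ := ‹Nonempty ι›
  have hmem : ∀ i, p i - p i₀ ∈ vectorSpan ℝ (range p) := fun i =>
    vsub_mem_vectorSpan ℝ (mem_range_self i) (mem_range_self i₀)
  let Φ : Module.Dual ℝ (vectorSpan ℝ (range p)) × ℝ →ₗ[ℝ] (ι → ℝ) :=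
    { toFun := fun a i => a.1 ⟨p i - p i₀, hmem i⟩ + a.2
      map_add' := fun a b => by
        ext i
        simp
        ring
      map_smul' := fun c a => by
        ext i
        simp
        ring }
  have hΦ : ∀ a i, Φ a i = a.1 ⟨p i - p i₀, hmem i⟩ + a.2 := fun a i => rfl
  have hinj : Function.Injective Φ := by
    rw [injective_iff_map_eq_zero]
    rintro ⟨φ, c⟩ h0
    have hz : ∀ i, φ ⟨p i - p i₀, hmem i⟩ + c = 0 := fun i => congrFun h0 i
    have hc : c = 0 := by
      have h1 := hz i₀
      have h2 : (⟨p i₀ - p i₀, hmem i₀⟩ : vectorSpan ℝ (range p)) = 0 := by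
        ext1
        simp
      rw [h2, map_zero, zero_add] at h1
      exact h1
    have hφ : φ = 0 := by
      obtain ⟨ψ, hψ⟩ := LinearMap.exists_extend φ
      have hspan : vectorSpan ℝ (range p) ≤ LinearMap.ker ψ := by
        rw [vectorSpan_range_eq_span_range_vsub_right ℝ p i₀, Submodule.span_le]
        rintro _ ⟨i, rfl⟩
        have h1 := hz i
        rw [hc, add_zero, ← hψ] at h1
        exact h1
      ext ⟨x, hx⟩
      rw [← hψ]
      exact hspan hx
    rw [hφ, hc]
    rfl
  have hrange : LinearMap.range (affineEval p) = LinearMap.range Φ := by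
    apply le_antisymm
    · rintro _ ⟨⟨l, c⟩, rfl⟩
      refine ⟨(l.comp (vectorSpan ℝ (range p)).subtype, l (p i₀) + c), ?_⟩
      ext i
      simp only [hΦ, affineEval_apply, LinearMap.comp_apply, Submodule.subtype_apply, map_sub]
      ring
    · rintro _ ⟨⟨φ, c⟩, rfl⟩
      obtain ⟨ψ, hψ⟩ := LinearMap.exists_extend φ
      refine ⟨(ψ, c - ψ (p i₀)), ?_⟩
      ext i
      simp only [hΦ, affineEval_apply, ← hψ, LinearMap.comp_apply, Submodule.subtype_apply, map_sub]
      ring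
  rw [hrange, LinearMap.finrank_range_of_inj hinj, Module.finrank_prod, Subspace.dual_finrank_eq,
    Module.finrank_self]

lemma range_restrictTo_range_affineEval {N : ℕ} {ι : Type*} (p : ι → Fin N → ℝ) (F : Finset ι) :
    LinearMap.range (restrictTo (LinearMap.range (affineEval p)) F) =
      LinearMap.range (affineEval fun v : F => p v) := by
  ext g
  constructor
  · rintro ⟨⟨_, a, rfl⟩, rfl⟩
    exact ⟨a, rfl⟩
  · rintro ⟨a, rfl⟩
    exact ⟨⟨_, a, rfl⟩, rfl⟩

lemma pdim_convexHull_range {N : ℕ} {ι : Type*} (p : ι → Fin N → ℝ) :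
    pdim (convexHull ℝ (range p)) = Module.finrank ℝ (vectorSpan ℝ (range p)) := by
  rw [pdim, affineSpan_convexHull, direction_affineSpan]

lemma IsExtremeZeroSet.finrank_vanishingOn {V : Type*} {U : Submodule ℝ (V → ℝ)} {F : Finset V}
    (hF : IsExtremeZeroSet U F) : Module.finrank ℝ (vanishingOn U F) = 1 := by
  obtain ⟨y, hyU, -, hy0, hyF, hext⟩ := hF
  have h : vanishingOn U F = Submodule.span ℝ {y} := by
    ext g
    rw [Submodule.mem_span_singleton]
    constructor
    · rintro ⟨hgU, hg⟩
      obtain ⟨c, hc⟩ := hext g hgU hg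
      exact ⟨c, hc.symm⟩
    · rintro ⟨c, rfl⟩
      exact (vanishingOn U F).smul_mem c ⟨hyU, fun v hv => (hyF v).1 hv⟩
  rw [h, finrank_span_singleton hy0]

lemma IsExtremeZeroSet.isFacetOf {N : ℕ} {S : Finset (Fin N → ℝ)} {F : Finset S}
    (hF : IsExtremeZeroSet (LinearMap.range (affineEval (Subtype.val : S → Fin N → ℝ))) F)
    (hne : F.Nonempty) :
    IsFacetOf (convexHull ℝ (S : Set (Fin N → ℝ)))
      (convexHull ℝ (range fun v : F => (v : Fin N → ℝ))) ∧
    ∀ s : S, (s : Fin N → ℝ) ∈ convexHull ℝ (range fun v : F => (v : Fin N → ℝ)) ↔ s ∈ F := by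
  have hvan := hF.finrank_vanishingOn
  obtain ⟨y, ⟨⟨l, c⟩, rfl⟩, hpos, -, hyF, -⟩ := hF
  simp only [affineEval_apply] at hpos hyF
  have hle : ∀ s ∈ S, (-l) s ≤ c := fun s hs => by
    have := hpos ⟨s, hs⟩
    rw [LinearMap.neg_apply]
    linarith
  have hset : (range fun v : F => (v : Fin N → ℝ)) = {s | s ∈ S ∧ (-l) s = c} := by
    ext s
    rw [mem_ofPred_eq, LinearMap.neg_apply]
    constructor
    · rintro ⟨v, rfl⟩
      have := (hyF v).1 v.2
      exact ⟨v.1.2, by linarith⟩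
    · rintro ⟨hs, h⟩
      exact ⟨⟨⟨s, hs⟩, (hyF ⟨s, hs⟩).2 (by linarith)⟩, rfl⟩
  have : Nonempty F := hne.to_subtype
  have : Nonempty S := ⟨hne.choose⟩
  refine ⟨⟨?_, convexHull_nonempty_iff.2 (range_nonempty _), ?_⟩,
    fun s => ⟨fun hs => ?_, fun hs => ?_⟩⟩
  · rw [hset]
    exact isExposed_convexHull_sep S hle
  · have h1 := finrank_range_restrictTo_add
      (LinearMap.range (affineEval (Subtype.val : S → Fin N → ℝ))) F
    rw [range_restrictTo_range_affineEval, finrank_range_affineEval, finrank_range_affineEval,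
      hvan, ← pdim_convexHull_range, ← pdim_convexHull_range, Subtype.range_coe] at h1
    exact Nat.succ_injective h1
  · rw [hset, ← sep_convexHull_eq S hle] at hs
    have := hs.2
    rw [LinearMap.neg_apply] at this
    exact (hyF s).2 (by linarith)
  · exact subset_convexHull ℝ _ ⟨⟨s, hs⟩, rfl⟩

lemma IsExposed.isVertex {N : ℕ} {P B : Set (Fin N → ℝ)} (hB : IsExposed ℝ P B)
    {v : Fin N → ℝ} (hv : IsVertex P v) (hvB : v ∈ B) : IsVertex B v :=
  IsExposed.mono hv hB.subset (singleton_subset_iff.2 hvB)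

lemma finite_facetSet {N : ℕ} (S : Finset (Fin N → ℝ)) :
    (facetSet (convexHull ℝ (S : Set (Fin N → ℝ)))).Finite := by
  refine (S.finite_toSet.finite_subsets.image (convexHull ℝ)).subset fun F hF => ?_
  exact ⟨{s | s ∈ S ∧ s ∈ F}, fun s hs => hs.1, hF.1.eq_convexHull_inter.symm⟩

lemma pairsExposed_of_twoNeighborly {N : ℕ} {S : Finset (Fin N → ℝ)}
    (hS : vertexSet (convexHull ℝ (S : Set (Fin N → ℝ))) = S)
    (hnb : TwoNeighborly (convexHull ℝ (S : Set (Fin N → ℝ)))) :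
    PairsExposed (LinearMap.range (affineEval (Subtype.val : S → Fin N → ℝ))) := by
  have hvert : ∀ s : S, IsVertex (convexHull ℝ (S : Set (Fin N → ℝ))) s := fun s =>
    hS.ge s.2
  intro u w huw
  have hexp := (hnb u w (hvert u) (hvert w) (Subtype.coe_ne_coe.2 huw)).1
  obtain ⟨l, c, hle, heq⟩ := hexp.exists_linearMap
    (convexHull_nonempty_iff.2 (insert_nonempty _ _))
  refine ⟨_, ⟨(-l, c), rfl⟩, fun v => ?_, fun v => ?_⟩
  · have := hle v (subset_convexHull ℝ _ v.2)
    rw [affineEval_apply, LinearMap.neg_apply]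
    linarith
  · have hv : (v : Fin N → ℝ) ∈ convexHull ℝ {(u : Fin N → ℝ), (w : Fin N → ℝ)} ↔
        v = u ∨ v = w := by
      refine ⟨fun h => ?_, fun h => subset_convexHull ℝ _ ?_⟩
      · have := vertexSet_convexHull_subset _ (toFinite _) (hexp.isVertex (hvert v) h)
        exact this.imp Subtype.ext Subtype.ext
      · exact h.imp (congrArg _) (congrArg _)
    rw [← hv, heq, affineEval_apply, LinearMap.neg_apply]
    refine ⟨fun h => ⟨subset_convexHull ℝ _ v.2, by linarith⟩, fun h => ?_⟩
    have := h.2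
    linarith

/-- For every integer `d ≥ 4`, if `P` is a 2-neighborly `d`-polytope with at least
`d + 4` vertices such that every facet of `P` has at most `d + 1` vertices, then `P` has at
least `2d + 3` facets. -/
theorem two_neighborly_small_facets_many_facets
    (d : ℕ) (hd : 4 ≤ d) {N : ℕ} (P : Set (Fin N → ℝ))
    (hP : IsPolytope P) (hdim : pdim P = d) (hnb : TwoNeighborly P)
    (hv : d + 4 ≤ (vertexSet P).ncard)
    (hfv : ∀ F, IsFacetOf P F → (vertexSet F).ncard ≤ d + 1) :
    2 * d + 3 ≤ (facetSet P).ncard := by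
  obtain ⟨S, rfl, hS⟩ := hP.exists_eq_convexHull_vertexSet
  rw [hS, ncard_coe_finset] at hv
  have : Nonempty S := (Finset.card_pos.1 (by omega : 0 < S.card)).to_subtype
  set U := LinearMap.range (affineEval (Subtype.val : S → Fin N → ℝ)) with hUdef
  have hU : Module.finrank ℝ U = d + 1 := by
    rw [hUdef, finrank_range_affineEval, ← pdim_convexHull_range, Subtype.range_coe]
    exact congrArg (· + 1) hdim
  have hone : (1 : S → ℝ) ∈ U := ⟨(0, 1), by ext; simp [affineEval_apply]⟩
  have hfacet : ∀ F, IsExtremeZeroSet U F →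
      IsFacetOf (convexHull ℝ (S : Set (Fin N → ℝ)))
        (convexHull ℝ (range fun v : F => (v : Fin N → ℝ))) ∧
      ∀ s : S, (s : Fin N → ℝ) ∈ convexHull ℝ (range fun v : F => (v : Fin N → ℝ)) ↔ s ∈ F :=
    fun F hF => hF.isFacetOf (Finset.card_pos.1 (by have := hF.finrank_le_card_add_one; omega))
  have hcard : ∀ F, IsExtremeZeroSet U F → F.card ≤ d + 1 := by
    intro F hF
    obtain ⟨h1, h2⟩ := hfacet F hF
    refine le_trans ?_ (hfv _ h1)
    have hfin : (vertexSet (convexHull ℝ (range fun v : F => (v : Fin N → ℝ)))).Finite :=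
      (finite_range _).subset (vertexSet_convexHull_subset _ (finite_range _))
    rw [← Finset.card_map (Function.Embedding.subtype _), ← ncard_coe_finset]
    refine ncard_le_ncard (fun s hs => ?_) hfin
    obtain ⟨v, hvF, rfl⟩ := Finset.mem_map.1 (Finset.mem_coe.1 hs)
    exact h1.1.isVertex (hS.ge v.2) ((h2 v).2 hvF)
  refine (card_extremeZeroSets_ge U hone (pairsExposed_of_twoNeighborly hS hnb) hd hU
    (by rwa [Fintype.card_coe]) hcard).trans ?_
  rw [← ncard_coe_finset]
  refine ncard_le_ncard_of_injOn
    (fun F : Finset S => convexHull ℝ (range fun v : F => (v : Fin N → ℝ)))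
    (fun F hF => (hfacet F (mem_extremeZeroSets.1 hF)).1) (fun F hF G hG hFG => ?_)
    (finite_facetSet S)
  ext s
  rw [← (hfacet F (mem_extremeZeroSets.1 hF)).2 s, ← (hfacet G (mem_extremeZeroSets.1 hG)).2 s]
  exact Set.ext_iff.1 hFG s
end

section
/- Let P be a 2-neighborly d-polytope with d ≥ 3, and let x, y, z be three distinct vertices of P such that the convex hull of {x, y, z} is disjoint from the convex hull of the remaining vertices of P. Then the triangle conv{x, y, z} is a 2-dimensional face of P. -/
open Set

section Faces

variable {E : Type*} [NormedAddCommGroup E] [NormedSpace ℝ E]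

/-- If a continuous functional is constant on `A` and strictly smaller on `B`, then it exposes
`convexHull ℝ A` in `convexHull ℝ (A ∪ B)`. -/
theorem isExposed_convexHull_union_of_lt {A B : Set E} (l : StrongDual ℝ E) (c : ℝ)
    (hA : ∀ a ∈ A, l a = c) (hB : ∀ b ∈ B, l b < c) :
    IsExposed ℝ (convexHull ℝ (A ∪ B)) (convexHull ℝ A) := by
  intro hne
  have hAne : A.Nonempty := convexHull_nonempty_iff.1 hne
  have hcA : ∀ a ∈ convexHull ℝ A, l a = c := fun a ha =>
    convexHull_min (t := {a | l a = c}) hA (convex_hyperplane l.toLinearMap.isLinear c) ha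
  have hcB : ∀ b ∈ convexHull ℝ B, l b < c := fun b hb =>
    convexHull_min (t := {b | l b < c}) hB (convex_halfSpace_lt l.toLinearMap.isLinear c) hb
  have hle : ∀ p ∈ convexHull ℝ (A ∪ B), l p ≤ c := fun p hp =>
    convexHull_min (t := {b | l b ≤ c})
      (union_subset (fun a ha => (hA a ha).le) (fun b hb => (hB b hb).le))
      (convex_halfSpace_le l.toLinearMap.isLinear c) hp
  refine ⟨l, Subset.antisymm ?_ ?_⟩
  · intro p hp
    refine ⟨convexHull_mono subset_union_left hp, fun q hq => ?_⟩
    rw [hcA p hp]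
    exact hle q hq
  · rintro p ⟨hp, hmax⟩
    obtain ⟨a₀, ha₀⟩ := hAne
    have hcp : c ≤ l p := by
      rw [← hA a₀ ha₀]
      exact hmax a₀ (subset_convexHull ℝ _ (Or.inl ha₀))
    rcases B.eq_empty_or_nonempty with rfl | hBne
    · simpa using hp
    · rw [convexHull_union ⟨a₀, ha₀⟩ hBne, mem_convexJoin] at hp
      obtain ⟨a, ha, b, hb, s, t, hs, ht, hst, rfl⟩ := hp
      have hla := hcA a ha
      have hlb := hcB b hb
      have ht0 : t = 0 := by
        by_contra h0
        have htpos : 0 < t := lt_of_le_of_ne ht (Ne.symm h0)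
        simp only [map_add, map_smul, smul_eq_mul, hla] at hcp
        have hs' : s = 1 - t := by linarith
        subst hs'
        nlinarith
      subst ht0
      have : s = 1 := by linarith
      subst this
      simpa using ha

/-- A continuous functional that is bounded below on an affine subspace is constant on it. -/
theorem AffineSubspace.apply_eq_of_forall_lt {Q : AffineSubspace ℝ E} (l : StrongDual ℝ E) {v : ℝ}
    (h : ∀ q ∈ Q, v < l q) {a b : E} (ha : a ∈ Q) (hb : b ∈ Q) : l a = l b := by
  by_contra hne
  have hne' : l b - l a ≠ 0 := fun h0 => hne (by linarith)
  have := h _ (AffineMap.lineMap_mem ((v - l a) / (l b - l a)) ha hb)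
  rw [AffineMap.lineMap_apply_module', map_add, map_smul, map_sub, smul_eq_mul,
    div_mul_cancel₀ _ hne'] at this
  linarith

/-- If the affine span of `A` misses the convex hull of the finite set `B`, then `convexHull ℝ A`
is an exposed face of `convexHull ℝ (A ∪ B)`. -/
theorem isExposed_convexHull_union_of_disjoint [FiniteDimensional ℝ E] {A B : Set E}
    (hB : B.Finite) (hAB : Disjoint (convexHull ℝ B) (affineSpan ℝ A : Set E)) :
    IsExposed ℝ (convexHull ℝ (A ∪ B)) (convexHull ℝ A) := by
  intro hne
  obtain ⟨a₀, ha₀⟩ := convexHull_nonempty_iff.1 hne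
  obtain ⟨l, u, v, hu, huv, hv⟩ := geometric_hahn_banach_compact_closed (convex_convexHull ℝ B)
    (hB.isCompact_convexHull ℝ) (affineSpan ℝ A).convex
    (AffineSubspace.closed_of_finiteDimensional _) hAB
  have hmem : ∀ a ∈ A, a ∈ affineSpan ℝ A := fun a ha => subset_affineSpan ℝ A ha
  refine isExposed_convexHull_union_of_lt l (l a₀)
    (fun a ha => AffineSubspace.apply_eq_of_forall_lt l hv (hmem a ha) (hmem a₀ ha₀))
    (fun b hb => ?_) hne
  have h1 := hu b (subset_convexHull ℝ B hb)
  have h2 := hv a₀ (hmem a₀ ha₀)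
  linarith

/-- An extreme set containing a proper convex combination contains its first endpoint. -/
theorem IsExtreme.left_mem_of_combo_mem {P F : Set E} (hF : IsExtreme ℝ P F) {u q e : E}
    (hu : u ∈ P) (hq : q ∈ P) (he : e ∈ F) {s t : ℝ} (hs : 0 < s) (ht : 0 < t)
    (hst : s + t = 1) (h : e = s • u + t • q) : u ∈ F :=
  hF.left_mem_of_mem_openSegment hu hq he ⟨s, t, hs, ht, hst, h.symm⟩

/-- An extreme point lying on a segment of the set is one of its endpoints. -/
theorem Wbtw.eq_or_eq_of_mem_extremePoints {P : Set E} {x y z : E} (hy : y ∈ P.extremePoints ℝ)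
    (hx : x ∈ P) (hz : z ∈ P) (h : Wbtw ℝ x y z) : x = y ∨ z = y :=
  (mem_extremePoints_iff_forall_segment.1 hy).2 x hx z hz (mem_segment_iff_wbtw.2 h)

theorem mem_affineSpan_triple_iff {x y z p : E} :
    p ∈ affineSpan ℝ {x, y, z} ↔ ∃ a b c : ℝ, a + b + c = 1 ∧ p = a • x + b • y + c • z := by
  rw [← affineSpan_insert_affineSpan,
    AffineSubspace.mem_affineSpan_insert_iff (left_mem_affineSpan_pair ℝ y z)]
  constructor
  · rintro ⟨r, q, hq, rfl⟩
    obtain ⟨s, rfl⟩ := mem_affineSpan_pair_iff_exists_lineMap_eq.1 hq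
    refine ⟨r, 1 - r - s, s, by ring, ?_⟩
    rw [AffineMap.lineMap_apply_module', vsub_eq_sub, vadd_eq_add]
    module
  · rintro ⟨a, b, c, habc, rfl⟩
    refine ⟨a, AffineMap.lineMap y z c, AffineMap.lineMap_mem_affineSpan_pair c y z, ?_⟩
    obtain rfl : b = 1 - a - c := by linarith
    rw [AffineMap.lineMap_apply_module', vsub_eq_sub, vadd_eq_add]
    module

/-- If `x` and `y` are distinct points of the convex set `P` with `x` extreme, and `z ∈ P`, then no
affine combination of `x, y, z` with negative coefficients at `y` and `z` lies in `P`. -/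
theorem affine_combination_notMem_of_neg_of_neg {P : Set E} (hP : Convex ℝ P) {x y z : E}
    (hx : x ∈ P.extremePoints ℝ) (hy : y ∈ P) (hz : z ∈ P) (hxy : x ≠ y)
    {a b c : ℝ} (hb : b < 0) (hc : c < 0) (habc : a + b + c = 1) :
    a • x + b • y + c • z ∉ P := by
  intro hp
  have ha : 0 < a := by linarith
  have hd : 0 < 1 - c := by linarith
  have hq : (1 / (1 - c)) • (a • x + b • y + c • z) + (-c / (1 - c)) • z ∈ P :=
    hP hp hz (by positivity) (div_nonneg (by linarith) hd.le) (by field_simp; ring)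
  refine hxy (Eq.symm ((isExtreme_singleton.2 hx).left_mem_of_combo_mem hy hq (mem_singleton x)
    (s := -b / a) (t := (1 - c) / a) (div_pos (by linarith) ha) (by positivity) ?_ ?_))
  · field_simp
    linarith
  · match_scalars <;> field_simp <;> ring

/-- Suppose `x`, `y` are extreme points of the convex set `P` and the segment between them is
extreme. Then no affine combination of `x, y, z` that lies in `P` has a negative coefficient
at `z`. -/
theorem nonneg_of_affine_combination_mem {P : Set E} (hP : Convex ℝ P) {x y z : E}
    (hx : x ∈ P.extremePoints ℝ) (hy : y ∈ P.extremePoints ℝ) (hz : z ∈ P.extremePoints ℝ)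
    (hxy : x ≠ y) (hxz : x ≠ z) (hyz : y ≠ z) (hedge : IsExtreme ℝ P (segment ℝ x y))
    {a b c : ℝ} (habc : a + b + c = 1) (hp : a • x + b • y + c • z ∈ P) : 0 ≤ c := by
  by_contra! hc
  rcases le_or_gt 0 a with ha | ha
  · rcases le_or_gt 0 b with hb | hb
    · have hab : 0 < a + b := by linarith
      have hmem : (a / (a + b)) • x + (b / (a + b)) • y ∈ segment ℝ x y :=
        ⟨_, _, by positivity, by positivity, by field_simp, rfl⟩
      have hzs : z ∈ segment ℝ x y := by
        refine hedge.left_mem_of_combo_mem hz.1 hp hmem (s := -c / (a + b)) (t := 1 / (a + b))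
          (div_pos (by linarith) hab) (by positivity) ?_ ?_
        · field_simp
          linarith
        · match_scalars <;> field_simp
          ring
      rcases (mem_segment_iff_wbtw.1 hzs).eq_or_eq_of_mem_extremePoints hz hx.1 hy.1 with h | h
      · exact hxz h
      · exact hyz h
    · exact affine_combination_notMem_of_neg_of_neg hP hx hy.1 hz.1 hxy hb hc habc hp
  · exact affine_combination_notMem_of_neg_of_neg hP hy hx.1 hz.1 hxy.symm ha hc
      (a := b) (by linarith) (by rwa [add_comm (b • y)])

end Faces

/-- A polytope has finitely many extreme points. -/
theorem IsPolytope.finite_extremePoints {N : ℕ} {P : Set (Fin N → ℝ)} (hP : IsPolytope P) :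
    (P.extremePoints ℝ).Finite := by
  obtain ⟨S, rfl⟩ := hP
  exact S.finite_toSet.subset extremePoints_convexHull_subset

theorem IsPolytope.convex {N : ℕ} {P : Set (Fin N → ℝ)} (hP : IsPolytope P) : Convex ℝ P := by
  obtain ⟨S, rfl⟩ := hP
  exact convex_convexHull ℝ _

theorem IsPolytope.isCompact {N : ℕ} {P : Set (Fin N → ℝ)} (hP : IsPolytope P) :
    IsCompact P := by
  obtain ⟨S, rfl⟩ := hP
  exact S.finite_toSet.isCompact_convexHull ℝ

theorem IsPolytope.convexHull_extremePoints {N : ℕ} {P : Set (Fin N → ℝ)} (hP : IsPolytope P) :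
    convexHull ℝ (P.extremePoints ℝ) = P := by
  rw [← (hP.finite_extremePoints.isCompact_convexHull ℝ).isClosed.closure_eq]
  exact closure_convexHull_extremePoints hP.isCompact hP.convex

theorem IsVertex.mem_extremePoints {N : ℕ} {P : Set (Fin N → ℝ)} {v : Fin N → ℝ}
    (hv : IsVertex P v) : v ∈ P.extremePoints ℝ :=
  isExtreme_singleton.1 (IsExposed.isExtreme hv)

/-- The vertices of a polytope are its extreme points. -/
theorem IsPolytope.vertexSet_eq {N : ℕ} {P : Set (Fin N → ℝ)} (hP : IsPolytope P) :
    vertexSet P = P.extremePoints ℝ := by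
  refine Subset.antisymm (fun v hv => IsVertex.mem_extremePoints hv) fun v hv => ?_
  have hnot := (hP.convex.mem_extremePoints_iff_mem_sdiff_convexHull_sdiff.1 hv).2
  have hexp := isExposed_convexHull_union_of_disjoint (A := {v}) (B := P.extremePoints ℝ \ {v})
    (hP.finite_extremePoints.subset sdiff_subset) (by
      rw [AffineSubspace.coe_affineSpan_singleton, disjoint_singleton_right]
      exact fun h => hnot (convexHull_mono (sdiff_subset_sdiff_left extremePoints_subset) h))
  rw [union_sdiff_cancel (singleton_subset_iff.2 hv), hP.convexHull_extremePoints,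
    convexHull_singleton] at hexp
  exact hexp

/-- If `x, y, z` are three distinct vertices of a 2-neighborly `d`-polytope `P`
(`d ≥ 3`) such that `conv {x, y, z}` is disjoint from the convex hull of the remaining vertices,
then the triangle `conv {x, y, z}` is a 2-dimensional face of `P`. -/
theorem triangle_is_face
    (d : ℕ) (hd : 3 ≤ d) {N : ℕ} (P : Set (Fin N → ℝ))
    (hP : IsPolytope P) (hdim : pdim P = d) (hnb : TwoNeighborly P)
    (x y z : Fin N → ℝ) (hx : IsVertex P x) (hy : IsVertex P y) (hz : IsVertex P z)
    (hxy : x ≠ y) (hxz : x ≠ z) (hyz : y ≠ z)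
    (hdisj : convexHull ℝ ({x, y, z} : Set (Fin N → ℝ)) ∩
      convexHull ℝ (vertexSet P \ {x, y, z}) = ∅) :
    IsExposed ℝ P (convexHull ℝ ({x, y, z} : Set (Fin N → ℝ))) ∧
    pdim (convexHull ℝ ({x, y, z} : Set (Fin N → ℝ))) = 2 := by
  have hx' := hx.mem_extremePoints
  have hy' := hy.mem_extremePoints
  have hz' := hz.mem_extremePoints
  have hedge : ∀ u v, IsVertex P u → IsVertex P v → u ≠ v → IsExtreme ℝ P (segment ℝ u v) := by
    intro u v hu hv huv
    rw [← convexHull_pair]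
    exact (hnb u v hu hv huv).1.isExtreme
  constructor
  · have hsub : ({x, y, z} : Set (Fin N → ℝ)) ⊆ vertexSet P := by
      rintro v (rfl | rfl | rfl) <;> assumption
    have hfin : (vertexSet P \ {x, y, z}).Finite := by
      rw [hP.vertexSet_eq]
      exact hP.finite_extremePoints.subset sdiff_subset
    have hconv : convexHull ℝ (vertexSet P) = P := by
      rw [hP.vertexSet_eq, hP.convexHull_extremePoints]
    have hexp := isExposed_convexHull_union_of_disjoint (A := {x, y, z}) hfin ?_
    · rwa [union_sdiff_cancel hsub, hconv] at hexp
    · rw [Set.disjoint_left]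
      intro p hpW hpT
      have hpP : p ∈ P := hconv ▸ convexHull_mono sdiff_subset hpW
      obtain ⟨a, b, c, habc, rfl⟩ := mem_affineSpan_triple_iff.1 hpT
      have hc : 0 ≤ c := nonneg_of_affine_combination_mem hP.convex hx' hy' hz' hxy hxz hyz
        (hedge x y hx hy hxy) habc hpP
      have hb : 0 ≤ b := nonneg_of_affine_combination_mem hP.convex hx' hz' hy' hxz hxy hyz.symm
        (hedge x z hx hz hxz) (a := a) (b := c) (by linarith) (by rwa [add_right_comm])
      have ha : 0 ≤ a := nonneg_of_affine_combination_mem hP.convex hy' hz' hx' hyz hxy.symm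
        hxz.symm (hedge y z hy hz hyz) (a := b) (b := c) (by linarith)
        (by rwa [add_right_comm, add_comm (b • y)])
      have hmem : a • x + b • y + c • z ∈ convexHull ℝ ({x, y, z} : Set (Fin N → ℝ)) := by
        have hsubset := subset_convexHull ℝ ({x, y, z} : Set (Fin N → ℝ))
        have := (convex_convexHull ℝ ({x, y, z} : Set (Fin N → ℝ))).sum_mem (t := Finset.univ)
          (w := ![a, b, c]) (z := ![x, y, z]) (by simp [Fin.forall_fin_succ, ha, hb, hc])
          (by simpa [Fin.sum_univ_three] using habc)
          (by simp [Fin.forall_fin_succ, hsubset (mem_insert x _),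
            hsubset (mem_insert_of_mem x (mem_insert y _)),
            hsubset (mem_insert_of_mem x (mem_insert_of_mem y (mem_singleton z)))])
        simpa [Fin.sum_univ_three] using this
      exact disjoint_left.1 (disjoint_iff_inter_eq_empty.2 hdisj) hmem hpW
  · have hind : AffineIndependent ℝ ![x, y, z] := by
      rw [affineIndependent_iff_not_collinear_set]
      intro hcol
      rcases hcol.wbtw_or_wbtw_or_wbtw with h | h | h
      · exact (h.eq_or_eq_of_mem_extremePoints hy' hx'.1 hz'.1).elim hxy hyz.symm
      · exact (h.eq_or_eq_of_mem_extremePoints hz' hy'.1 hx'.1).elim hyz hxz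
      · exact (h.eq_or_eq_of_mem_extremePoints hx' hz'.1 hy'.1).elim hxz.symm hxy.symm
    have hfr := hind.finrank_vectorSpan (n := 2) (by simp)
    rw [pdim, affineSpan_convexHull, direction_affineSpan]
    rwa [Matrix.range_cons, Matrix.range_cons_cons_empty, singleton_union] at hfr
end

section
/- Let P be a 2-neighborly d-polytope (d ≥ 4) that is not a pyramid. Then for every vertex v of P there are at least 3 facets of P that do not contain v. -/
open Set

theorem IsVertex.mem {N : ℕ} {P : Set (Fin N → ℝ)} {v : Fin N → ℝ}
    (hv : IsVertex P v) : v ∈ P :=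
  hv.mem_extremePoints.1

/-- A polytope has only finitely many exposed faces. -/
theorem IsPolytope.finite_setOf_isExposed {N : ℕ} {P : Set (Fin N → ℝ)} (hP : IsPolytope P) :
    {F : Set (Fin N → ℝ) | IsExposed ℝ P F}.Finite := by
  obtain ⟨S, rfl⟩ := hP
  refine (S.finite_toSet.finite_subsets.image fun A =>
    closure (convexHull ℝ A)).subset ?_
  intro F hF
  refine ⟨F.extremePoints ℝ, ?_, ?_⟩
  · exact hF.isExtreme.extremePoints_subset_extremePoints.trans extremePoints_convexHull_subset
  · exact closure_convexHull_extremePoints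
      (hF.isCompact (S.finite_toSet.isCompact_convexHull ℝ)) (hF.convex (convex_convexHull ℝ _))

/-- A linear functional vanishing on a submodule that does not contain all directions of a polytope
can be chosen to increase from a given point towards one of the generators. -/
theorem exists_dual_lt_of_vectorSpan_not_le {E : Type*} [AddCommGroup E] [Module ℝ E]
    {S : Set E} {W : Submodule ℝ E} (hW : ¬ vectorSpan ℝ S ≤ W) (p : E) :
    ∃ f : Module.Dual ℝ E, W ≤ LinearMap.ker f ∧ ∃ s ∈ S, f p < f s := by
  obtain ⟨x, hx, hxW⟩ := SetLike.not_le_iff_exists.1 hW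
  obtain ⟨f, hfx, hfW⟩ := Submodule.exists_le_ker_of_notMem hxW
  have hne : ∃ s ∈ S, f s ≠ f p := by
    by_contra! h
    refine hfx (LinearMap.mem_ker.1 ((?_ : vectorSpan ℝ S ≤ LinearMap.ker f) hx))
    rw [vectorSpan_def, Submodule.span_le]
    rintro _ ⟨a, ha, b, hb, rfl⟩
    simp [h a ha, h b hb]
  obtain ⟨s, hs, hsp⟩ := hne
  rcases lt_or_gt_of_ne hsp with h | h
  · refine ⟨-f, fun y hy => ?_, s, hs, by simpa using h⟩
    simpa using hfW hy
  · exact ⟨f, hfW, s, hs, h⟩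

/-- Rotating a supporting hyperplane of `convexHull ℝ S` along a functional `m`: the functional
`l + t • m` still attains its maximum at `p`, and also at a generator where `m` is larger. -/
theorem exists_rotation {E : Type*} [AddCommGroup E] [Module ℝ E] (S : Finset E)
    (l m : Module.Dual ℝ E) (p : E) (hl : ∀ s ∈ S, l s ≤ l p) (hm : ∃ s ∈ S, m p < m s) :
    ∃ t : ℝ, (∀ s ∈ S, (l + t • m) s ≤ (l + t • m) p) ∧
      ∃ s ∈ S, m p < m s ∧ (l + t • m) s = (l + t • m) p := by
  classical
  obtain ⟨s₁, hs₁, hms₁⟩ := hm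
  obtain ⟨s₀, hs₀, hmin⟩ := (S.filter fun s => m p < m s).exists_min_image
    (fun s => (l p - l s) / (m s - m p)) ⟨s₁, by simp [hs₁, hms₁]⟩
  rw [Finset.mem_filter] at hs₀
  have hpos : 0 < m s₀ - m p := sub_pos.2 hs₀.2
  have ht : 0 ≤ (l p - l s₀) / (m s₀ - m p) :=
    div_nonneg (sub_nonneg.2 (hl _ hs₀.1)) hpos.le
  have heq : (l p - l s₀) / (m s₀ - m p) * (m s₀ - m p) = l p - l s₀ :=
    div_mul_cancel₀ _ hpos.ne'
  refine ⟨(l p - l s₀) / (m s₀ - m p), fun s hs => ?_, s₀, hs₀.1, hs₀.2, ?_⟩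
  · simp only [LinearMap.add_apply, LinearMap.smul_apply, smul_eq_mul]
    by_cases h : m p < m s
    · have h1 := hmin s (by simp [hs, h])
      rw [le_div_iff₀ (sub_pos.2 h)] at h1
      linarith
    · nlinarith [hl s hs, mul_nonneg ht (sub_nonneg.2 (not_lt.1 h))]
  · simp only [LinearMap.add_apply, LinearMap.smul_apply, smul_eq_mul]
    linarith

/-- A nonempty exposed face of a polytope is contained in a facet missing any prescribed point of
the polytope outside the face. -/
theorem IsPolytope.exists_isFacetOf_of_notMem {N : ℕ} {P G : Set (Fin N → ℝ)}
    (hP : IsPolytope P) (hG : IsExposed ℝ P G) (hGne : G.Nonempty) {v : Fin N → ℝ}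
    (hvP : v ∈ P) (hvG : v ∉ G) : ∃ F, IsFacetOf P F ∧ v ∉ F ∧ G ⊆ F := by
  have hfin : {F : Set (Fin N → ℝ) | IsExposed ℝ P F ∧ v ∉ F ∧ G ⊆ F}.Finite :=
    hP.finite_setOf_isExposed.subset fun F hF => hF.1
  obtain ⟨F, ⟨hF, hvF, hGF⟩, hmax⟩ := hfin.exists_maximal ⟨G, hG, hvG, subset_refl G⟩
  refine ⟨F, ⟨hF, hGne.mono hGF, ?_⟩, hvF, hGF⟩
  obtain ⟨p, hpF⟩ := hGne.mono hGF
  obtain ⟨l, hl⟩ := hF ⟨p, hpF⟩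
  have hFP : F ⊆ P := hF.subset
  have hpP : p ∈ P := hFP hpF
  have hlp : ∀ y ∈ P, l y ≤ l p := by
    rw [hl] at hpF
    exact hpF.2
  have hlF : ∀ x ∈ F, l x = l p := fun x hx => by
    refine le_antisymm (hlp x (hFP hx)) ?_
    rw [hl] at hx
    exact hx.2 p hpP
  have hlv : l v < l p := by
    refine lt_of_le_of_ne (hlp v hvP) fun h => hvF ?_
    rw [hl]
    exact ⟨hvP, fun y hy => h ▸ hlp y hy⟩
  have hvspan : v - p ∉ vectorSpan ℝ F := by
    intro h
    have hle : vectorSpan ℝ F ≤ LinearMap.ker (l : (Fin N → ℝ) →ₗ[ℝ] ℝ) := by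
      rw [vectorSpan_def, Submodule.span_le]
      rintro _ ⟨a, ha, b, hb, rfl⟩
      simp [hlF a ha, hlF b hb]
    have := hle h
    simp only [LinearMap.mem_ker, ContinuousLinearMap.coe_coe, map_sub] at this
    linarith
  rw [pdim, pdim, direction_affineSpan, direction_affineSpan,
    ← Submodule.finrank_sup_span_singleton hvspan]
  suffices vectorSpan ℝ F ⊔ Submodule.span ℝ {v - p} = vectorSpan ℝ P by rw [this]
  refine le_antisymm (sup_le (vectorSpan_mono ℝ hFP) ?_) ?_
  · rw [Submodule.span_singleton_le_iff_mem]
    exact vsub_mem_vectorSpan ℝ hvP hpP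
  by_contra hnot
  obtain ⟨S, rfl⟩ := hP
  rw [← direction_affineSpan ℝ (convexHull ℝ (S : Set (Fin N → ℝ))), affineSpan_convexHull,
    direction_affineSpan] at hnot
  obtain ⟨m, hmW, hm⟩ := exists_dual_lt_of_vectorSpan_not_le hnot p
  have hmF : ∀ x ∈ F, m x = m p := fun x hx => by
    have := hmW (Submodule.mem_sup_left (vsub_mem_vectorSpan ℝ hx hpF))
    simpa [sub_eq_zero] using this
  have hmv : m v = m p := by
    have := hmW (Submodule.mem_sup_right (Submodule.mem_span_singleton_self (v - p)))
    simpa [sub_eq_zero] using this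
  obtain ⟨t, hk, s, hs, hms, hks⟩ := exists_rotation S (l : (Fin N → ℝ) →ₗ[ℝ] ℝ) m p
    (fun s hs => hlp s (subset_convexHull ℝ _ hs)) hm
  set k : (Fin N → ℝ) →ₗ[ℝ] ℝ := (l : (Fin N → ℝ) →ₗ[ℝ] ℝ) + t • m with hkdef
  have hkapp : ∀ x, k x = l x + t * m x := fun x => rfl
  have hkP : ∀ x ∈ convexHull ℝ (S : Set (Fin N → ℝ)), k x ≤ k p :=
    convexHull_min hk (convex_halfSpace_le k.isLinear (k p))
  let F' : Set (Fin N → ℝ) := (LinearMap.toContinuousLinearMap k).toExposed (convexHull ℝ S)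
  have hF' : ∀ x, x ∈ F' ↔ x ∈ convexHull ℝ (S : Set (Fin N → ℝ)) ∧ k x = k p := fun x =>
    ⟨fun hx => ⟨hx.1, le_antisymm (hkP x hx.1) (hx.2 p hpP)⟩,
      fun hx => ⟨hx.1, fun y hy => (hkP y hy).trans_eq hx.2.symm⟩⟩
  have hFF' : F ⊆ F' := fun x hx =>
    (hF' x).2 ⟨hFP hx, by rw [hkapp, hkapp, hlF x hx, hmF x hx]⟩
  have hvF' : v ∉ F' := fun h => by
    have := ((hF' v).1 h).2
    rw [hkapp, hkapp, hmv] at this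
    linarith
  have hsF' : s ∈ F' := (hF' s).2 ⟨subset_convexHull ℝ _ hs, hks⟩
  have hsF : s ∈ F :=
    hmax ⟨ContinuousLinearMap.toExposed.isExposed, hvF', hGF.trans hFF'⟩ hFF' hsF'
  exact hms.ne' (hmF s hsF)

/-- If a set is not a pyramid, an exposed face missing the vertex `v` misses another vertex. -/
theorem exists_isVertex_ne_notMem {N : ℕ} {P F : Set (Fin N → ℝ)} (hpyr : ¬ IsPyramid P)
    {v : Fin N → ℝ} (hv : IsVertex P v) (hF : IsExposed ℝ P F) (hvF : v ∉ F) :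
    ∃ w, IsVertex P w ∧ w ≠ v ∧ w ∉ F := by
  by_contra! h
  have hspan : v ∈ affineSpan ℝ (vertexSet P \ {v}) := by
    by_contra hv'
    exact hpyr ⟨v, hv, hv'⟩
  have hsub : vertexSet P \ {v} ⊆ F := fun w hw => h w hw.1 hw.2
  obtain ⟨p, hp⟩ : F.Nonempty := ((affineSpan_nonempty ℝ).1 ⟨v, hspan⟩).mono hsub
  obtain ⟨l, hl⟩ := hF ⟨p, hp⟩
  have hp' := hp
  rw [hl] at hp'
  have hle : vectorSpan ℝ F ≤ LinearMap.ker (l : (Fin N → ℝ) →ₗ[ℝ] ℝ) := by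
    rw [vectorSpan_def, Submodule.span_le]
    rintro _ ⟨a, ha, b, hb, rfl⟩
    rw [hl] at ha hb
    simp [le_antisymm (hb.2 a ha.1) (ha.2 b hb.1)]
  have hvp : l v = l p := by
    have := hle (direction_affineSpan ℝ F ▸ AffineSubspace.vsub_mem_direction
      (affineSpan_mono ℝ hsub hspan) (subset_affineSpan ℝ F hp))
    simpa [sub_eq_zero] using this
  refine hvF ?_
  rw [hl]
  exact ⟨hv.mem, fun y hy => hvp ▸ hp'.2 y hy⟩

/-- If a 2-neighborly `d`-polytope `P` (`d ≥ 4`) is not a pyramid, then for every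
vertex `v` of `P` there are at least 3 facets of `P` that do not contain `v`. -/
theorem non_pyramid_vertex_misses_three_facets
    (d : ℕ) (hd : 4 ≤ d) {N : ℕ} (P : Set (Fin N → ℝ))
    (hP : IsPolytope P) (hdim : pdim P = d) (hnb : TwoNeighborly P)
    (hpyr : ¬ IsPyramid P) :
    ∀ v : Fin N → ℝ, IsVertex P v →
      3 ≤ {F : Set (Fin N → ℝ) | IsFacetOf P F ∧ v ∉ F}.ncard := by
  intro v hv
  have hfin : {F : Set (Fin N → ℝ) | IsFacetOf P F ∧ v ∉ F}.Finite :=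
    hP.finite_setOf_isExposed.subset fun F hF => hF.1.1
  have facet : ∀ w, IsVertex P w → w ≠ v → ∃ F, IsFacetOf P F ∧ v ∉ F ∧ w ∈ F := by
    intro w hw hwv
    obtain ⟨F, hF, hvF, hwF⟩ := hP.exists_isFacetOf_of_notMem hw (singleton_nonempty w) hv.mem
      (by simpa using hwv.symm)
    exact ⟨F, hF, hvF, hwF rfl⟩
  obtain ⟨w₀, hw₀, hw₀v, -⟩ :=
    exists_isVertex_ne_notMem hpyr hv isExposed_empty (notMem_empty v)
  obtain ⟨F₁, hF₁, hvF₁, -⟩ := facet w₀ hw₀ hw₀v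
  obtain ⟨w₁, hw₁, hw₁v, hw₁F₁⟩ := exists_isVertex_ne_notMem hpyr hv hF₁.1 hvF₁
  obtain ⟨F₂, hF₂, hvF₂, hw₁F₂⟩ := facet w₁ hw₁ hw₁v
  obtain ⟨w₂, hw₂, hw₂v, hw₂F₂⟩ := exists_isVertex_ne_notMem hpyr hv hF₂.1 hvF₂
  have hne : w₁ ≠ w₂ := fun h => hw₂F₂ (h ▸ hw₁F₂)
  have hedge : v ∉ convexHull ℝ {w₁, w₂} := by
    rw [convexHull_pair]
    intro h
    rcases (mem_extremePoints_iff_forall_segment.1 hv.mem_extremePoints).2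
      w₁ hw₁.mem w₂ hw₂.mem h with h | h
    · exact hw₁v h
    · exact hw₂v h
  obtain ⟨F₃, hF₃, hvF₃, hsub⟩ := hP.exists_isFacetOf_of_notMem (hnb w₁ w₂ hw₁ hw₂ hne).1
    ⟨w₁, subset_convexHull ℝ _ (by simp)⟩ hv.mem hedge
  have hw₁F₃ : w₁ ∈ F₃ := hsub (subset_convexHull ℝ _ (by simp))
  have hw₂F₃ : w₂ ∈ F₃ := hsub (subset_convexHull ℝ _ (by simp))
  refine (two_lt_ncard_iff hfin).2 ⟨F₁, F₂, F₃, ⟨hF₁, hvF₁⟩, ⟨hF₂, hvF₂⟩, ⟨hF₃, hvF₃⟩, ?_, ?_, ?_⟩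
  · exact fun h => hw₁F₁ (h ▸ hw₁F₂)
  · exact fun h => hw₁F₁ (h ▸ hw₁F₃)
  · exact fun h => hw₂F₂ (h ▸ hw₂F₃)
end

section
/- Let n ≥ 2 and let m : ℤ → ℕ be 2n-periodic (m(i+2n) = m(i) for all i) and satisfy the neighborliness condition: for every i, m(i+1) + m(i+2) + ⋯ + m(i+n−1) ≥ 3. Define the cofacet count N(m) = Σ_{i=0}^{n−1} m(i)·m(i+n) + Σ m(i)·m(j)·m(k), where the second sum ranges over all triples 0 ≤ i < j < k < 2n with j−i < n, k−j < n, and 2n−(k−i) < n. If m(i₀) > 0 for some i₀, and m′ is the 2n-periodic function obtained from m by decreasing the value at i₀ (and all its residues mod 2n) by 1, then N(m′) ≤ N(m) − 3. -/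
open Finset

/-- The number of cofacets (counted with multiplicity) of a reduced Gale diagram on the regular
`2n`-gon with multiplicity function `m`: pairs of points at opposite vertices `i`, `i + n`, plus
triples of points at vertices `i < j < k` forming a triangle containing the center in its
interior (expressed by `j - i < n`, `k - j < n`, `2n - (k - i) < n`). -/
def cofacetCount (n : ℕ) (m : ℤ → ℕ) : ℕ :=
  (∑ i ∈ Finset.range n, m (i : ℤ) * m ((i : ℤ) + (n : ℤ))) +
  ∑ t ∈ (Finset.range (2 * n) ×ˢ Finset.range (2 * n) ×ˢ Finset.range (2 * n)).filter
      (fun t => t.1 < t.2.1 ∧ t.2.1 < t.2.2 ∧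
        t.2.1 - t.1 < n ∧ t.2.2 - t.2.1 < n ∧ 2 * n - (t.2.2 - t.1) < n),
    m (t.1 : ℤ) * m (t.2.1 : ℤ) * m (t.2.2 : ℤ)

/-- If every `n - 1` consecutive labels sum to at least 3, some vertex `r + s` with positive label
in the open half-turn after `r` sees total label at least 3 among `r + n` and the vertices
`r + b` with `n < b < n + s`. -/
lemma exists_pos_three_le_sum {n : ℕ} (M : ℕ → ℕ)
    (hnb : ∀ i, 3 ≤ ∑ j ∈ Ico 1 n, M (i + j)) (r : ℕ) :
    ∃ s, 0 < s ∧ s < n ∧ 0 < M (r + s) ∧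
      3 ≤ M (r + n) + ∑ b ∈ Ico (n + 1) (n + s), M (r + b) := by
  have hne : ((Ico 1 n).filter fun s => 0 < M (r + s)).Nonempty := by
    by_contra h
    rw [not_nonempty_iff_eq_empty, filter_eq_empty_iff] at h
    have h0 : ∑ j ∈ Ico 1 n, M (r + j) = 0 :=
      sum_eq_zero fun j hj => Nat.eq_zero_of_not_pos (h hj)
    have := hnb r
    omega
  obtain ⟨s, hs, hmax⟩ := exists_max_image _ id hne
  simp only [mem_filter, mem_Ico, id] at hs hmax
  refine ⟨s, by omega, by omega, hs.2, ?_⟩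
  have hwin : ∑ j ∈ Ico 1 n, M (r + s + j) = ∑ b ∈ Ico (s + 1) (s + n), M (r + b) := by
    rw [add_comm s 1, add_comm s n, ← sum_Ico_add' (fun b => M (r + b)) 1 n s]
    exact sum_congr rfl fun j _ => congrArg M (by omega)
  have hzero : ∑ b ∈ Ico (s + 1) n, M (r + b) = 0 := by
    refine sum_eq_zero fun b hb => Nat.eq_zero_of_not_pos fun hpos => ?_
    rw [mem_Ico] at hb
    have := hmax b ⟨⟨by omega, hb.2⟩, hpos⟩
    omega
  have h3 := hnb (r + s)
  rw [hwin, ← sum_Ico_consecutive _ (by omega : s + 1 ≤ n) (by omega : n ≤ s + n), hzero,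
    sum_eq_sum_Ico_succ_bot (by omega : n < s + n), add_comm s n] at h3
  omega

/-- If `f' ≤ f` on `T` and `f` exceeds `f'` by at least `g b` at the image of `b` under an
injection of `S` into `T`, then the sums over `T` differ by at least the sum of `g` over `S`. -/
lemma sum_add_sum_le_sum_of_injOn {α β : Type*} [DecidableEq β] {S : Finset α} {T : Finset β}
    (φ : α → β) (f f' : β → ℕ) (g : α → ℕ) (hφ : ∀ b ∈ S, φ b ∈ T)
    (hinj : Set.InjOn φ S) (hle : ∀ t ∈ T, f' t ≤ f t)
    (hg : ∀ b ∈ S, f' (φ b) + g b ≤ f (φ b)) :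
    ∑ t ∈ T, f' t + ∑ b ∈ S, g b ≤ ∑ t ∈ T, f t := by
  have himg : S.image φ ⊆ T := image_subset_iff.2 hφ
  rw [← sum_sdiff himg, ← sum_sdiff (f := f) himg, sum_image hinj, sum_image hinj, add_assoc,
    ← sum_add_distrib]
  exact add_le_add (sum_le_sum fun t ht => hle t (mem_sdiff.1 ht).1) (sum_le_sum hg)

/-- Lowering the label at `r` by one loses at least the opposite label together with the cofacet
triangles on `r` and a fixed positively labelled vertex `r + s`. -/
lemma cofacetCount_add_le {n : ℕ} {m m' : ℤ → ℕ}
    (hper : ∀ i : ℕ, m ((i + 2 * n : ℕ) : ℤ) = m (i : ℤ))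
    (hle : ∀ i, m' i ≤ m i) {r : ℕ} (hr : r < 2 * n) (hmr : m' r + 1 = m r)
    {s : ℕ} (hs0 : 0 < s) (hsn : s < n) (hs : 0 < m ((r + s : ℕ) : ℤ)) :
    cofacetCount n m' + (m ((r + n : ℕ) : ℤ) +
      ∑ b ∈ Ico (n + 1) (n + s), m ((r + b : ℕ) : ℤ)) ≤ cofacetCount n m := by
  have hshift : ∀ i : ℕ, 2 * n ≤ i → m ((i - 2 * n : ℕ) : ℤ) = m (i : ℤ) := fun i hi => by
    rw [← hper (i - 2 * n), Nat.sub_add_cancel hi]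
  have hpair : ∀ q : ℤ, m' r * m' q + m q ≤ m r * m q := fun q => by
    rw [← hmr, add_one_mul]
    exact Nat.add_le_add_right (Nat.mul_le_mul_left _ (hle q)) _
  have htri : ∀ p q : ℤ, 0 < m p → m' r * m' p * m' q + m q ≤ m r * m p * m q := fun p q hp => by
    rw [← hmr, add_one_mul, add_mul]
    exact add_le_add (Nat.mul_le_mul (Nat.mul_le_mul_left _ (hle p)) (hle q))
      (Nat.le_mul_of_pos_left _ hp)
  have hpairs : (∑ i ∈ range n, m' (i : ℤ) * m' ((i : ℤ) + n)) + m ((r + n : ℕ) : ℤ) ≤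
      ∑ i ∈ range n, m (i : ℤ) * m ((i : ℤ) + n) := by
    have key := sum_add_sum_le_sum_of_injOn (S := {r}) (T := range n)
      (fun _ => if r < n then r else r - n)
      (fun i : ℕ => m (i : ℤ) * m ((i : ℤ) + n)) (fun i : ℕ => m' (i : ℤ) * m' ((i : ℤ) + n))
      (fun _ => m ((r + n : ℕ) : ℤ)) ?_ (by simp) (fun i _ => Nat.mul_le_mul (hle _) (hle _)) ?_
    · simpa using key
    · intro b _
      simp only [mem_range]
      split_ifs <;> omega
    · intro b _
      split_ifs with h
      · exact_mod_cast hpair ((r : ℤ) + n)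
      · have e : ((r - n : ℕ) : ℤ) + n = r := by omega
        have e' : m ((r + n : ℕ) : ℤ) = m ((r - n : ℕ) : ℤ) := by
          rw [← hshift (r + n) (by omega)]
          congr 2
          omega
        rw [e, e', mul_comm, mul_comm (m _)]
        exact hpair _
  have htris := sum_add_sum_le_sum_of_injOn (S := Ico (n + 1) (n + s))
    (T := (range (2 * n) ×ˢ range (2 * n) ×ˢ range (2 * n)).filter
      (fun t => t.1 < t.2.1 ∧ t.2.1 < t.2.2 ∧
        t.2.1 - t.1 < n ∧ t.2.2 - t.2.1 < n ∧ 2 * n - (t.2.2 - t.1) < n))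
    (fun b => if r + b < 2 * n then (r, r + s, r + b)
      else if r + s < 2 * n then (r + b - 2 * n, r, r + s)
      else (r + s - 2 * n, r + b - 2 * n, r))
    (fun t => m (t.1 : ℤ) * m (t.2.1 : ℤ) * m (t.2.2 : ℤ))
    (fun t => m' (t.1 : ℤ) * m' (t.2.1 : ℤ) * m' (t.2.2 : ℤ))
    (fun b => m ((r + b : ℕ) : ℤ)) ?_ ?_
    (fun t _ => Nat.mul_le_mul (Nat.mul_le_mul (hle _) (hle _)) (hle _)) ?_
  · unfold cofacetCount
    omega
  · intro b hb
    rw [mem_Ico] at hb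
    simp only [mem_filter, mem_product, mem_range]
    split_ifs <;> dsimp only <;> omega
  · intro b hb c hc h
    simp only [coe_Ico, Set.mem_Ico] at hb hc
    dsimp only at h
    split_ifs at h <;> simp only [Prod.mk.injEq] at h <;> omega
  · intro b hb
    rw [mem_Ico] at hb
    split_ifs with h h'
    · exact htri _ _ hs
    · rw [← hshift (r + b) (by omega)]
      have := htri ((r + s : ℕ) : ℤ) ((r + b - 2 * n : ℕ) : ℤ) hs
      linarith
    · rw [← hshift (r + b) (by omega)]
      rw [← hshift (r + s) (by omega)] at hs
      have := htri ((r + s - 2 * n : ℕ) : ℤ) ((r + b - 2 * n : ℕ) : ℤ) hs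
      linarith

/-- Let `n ≥ 2` and let `m : ℤ → ℕ` be `2n`-periodic and satisfy the neighborliness
condition (the sum of any `n - 1` consecutive labels `m (i+1) + ⋯ + m (i+n-1)` is at least 3).
If `m i₀ > 0` and `m'` is obtained from `m` by decreasing the value at `i₀` (and all its residues
mod `2n`) by 1, then the cofacet count of `m'` is at most the cofacet count of `m` minus 3. -/
theorem cofacetCount_decrease
    (n : ℕ) (hn : 2 ≤ n) (m : ℤ → ℕ)
    (hper : ∀ i : ℤ, m (i + 2 * n) = m i)
    (hnb : ∀ i : ℤ, 3 ≤ ∑ j ∈ Finset.Ico 1 n, m (i + (j : ℤ)))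
    (i₀ : ℤ) (hpos : 0 < m i₀)
    (m' : ℤ → ℕ)
    (hm' : ∀ i : ℤ, m' i = if ((2 * n : ℤ)) ∣ (i - i₀) then m i - 1 else m i) :
    cofacetCount n m' + 3 ≤ cofacetCount n m := by
  have hperiodic : Function.Periodic m (2 * n : ℤ) := hper
  have hn0 : (0 : ℤ) < 2 * n := by omega
  obtain ⟨r, hr⟩ := Int.eq_ofNat_of_zero_le (Int.emod_nonneg i₀ hn0.ne')
  have hrlt : r < 2 * n := by
    have := Int.emod_lt_of_pos i₀ hn0
    omega
  have hdvd : (2 * n : ℤ) ∣ (r - i₀) := by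
    rw [← hr]
    exact (Int.mod_modEq i₀ _).symm.dvd
  have hmr : m r = m i₀ := by
    obtain ⟨k, hk⟩ := hdvd
    rw [show (r : ℤ) = i₀ + k * (2 * n) by linarith]
    exact hperiodic.int_mul k i₀
  have hm'r : m' r + 1 = m r := by
    rw [hm', if_pos hdvd]
    omega
  have hle : ∀ i, m' i ≤ m i := fun i => by
    rw [hm']
    split_ifs <;> omega
  obtain ⟨s, hs0, hsn, hs, h3⟩ := exists_pos_three_le_sum (fun k => m (k : ℤ))
    (fun i => by simpa using hnb i) r
  have := cofacetCount_add_le (fun i => by simpa using hper i) hle hrlt hm'r hs0 hsn hs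
  omega
end
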